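/- arXiv:2604.22412 — 3 statements merged into one kernel-verified Lean document; each statement's English description precedes it below -/
import Mathlib

section
/- There exists a function k : ℕ → ℕ such that every free group (the free group FreeGroup α on an arbitrary type α) has k as a modulus of uniform exactness, i.e., free groups are uniformly exact with a common modulus. -/
open scoped Pointwise

/-- A group `Γ` has `k : ℕ → ℕ` as a modulus of uniform exactness (`Γ ∈ UE(k)`):
for every finite unital symmetric subset `F ⊆ Γ` there is a map `η : Γ → Prob(Γ)`
with all `η^x` supported in the product set `F^{k(|F|)}` and
`∑_{s ∈ F} sup_x ‖η^{sx} - s·η^x‖₁ ≤ 1/|F|`. -/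
def IsUEModulus (k : ℕ → ℕ) (Γ : Type*) [Group Γ] : Prop :=
  ∀ F : Finset Γ, (1 : Γ) ∈ F → (∀ t ∈ F, t⁻¹ ∈ F) →
    ∃ η : Γ → Γ → ℝ,
      (∀ x t, 0 ≤ η x t) ∧
      (∀ x, Function.support (η x) ⊆ (F : Set Γ) ^ k F.card) ∧
      (∀ x, ∑ᶠ t, η x t = 1) ∧
      (∑ s ∈ F, ⨆ x : Γ, ∑ᶠ t, |η (s * x) t - η x (s⁻¹ * t)|) ≤ 1 / (F.card : ℝ)

/-- The length of the longest common prefix of two lists. -/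
def lcpLength {β : Type*} [DecidableEq β] : List β → List β → ℕ
  | a :: l, b :: m => if a = b then lcpLength l m + 1 else 0
  | _, _ => 0

section LcpLength

variable {β : Type*} [DecidableEq β]

lemma lcpLength_comm (l m : List β) : lcpLength l m = lcpLength m l := by
  induction l generalizing m with
  | nil => cases m <;> simp [lcpLength]
  | cons a l ih => cases m <;> simp [lcpLength, ih, eq_comm]

lemma lcpLength_le_length (l m : List β) : lcpLength l m ≤ l.length := by
  induction l generalizing m with
  | nil => cases m <;> simp [lcpLength]
  | cons a l ih =>
    cases m with
    | nil => simp [lcpLength]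
    | cons b m =>
      have := ih m
      simp only [lcpLength, List.length_cons]
      split_ifs <;> omega

lemma min_lcpLength_le (l m n : List β) :
    min (lcpLength l m) (lcpLength m n) ≤ lcpLength l n := by
  induction l generalizing m n with
  | nil => simp [lcpLength]
  | cons a l ih =>
    cases m with
    | nil => simp [lcpLength]
    | cons b m =>
      cases n with
      | nil => simp [lcpLength]
      | cons c n =>
        have := ih m n
        simp only [lcpLength]
        split_ifs <;> simp_all

lemma lcpLength_take (l : List β) {t : ℕ} (ht : t ≤ l.length) :
    lcpLength (l.take t) l = t := by
  induction l generalizing t with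
  | nil => simp_all [lcpLength]
  | cons a l ih =>
    cases t with
    | zero => simp [lcpLength]
    | succ t => simp_all [lcpLength]

end LcpLength

namespace FreeGroup

variable {α : Type*} [DecidableEq α]

lemma norm_inv_mul_add_lcpLength {l m : List (α × Bool)} (hl : IsReduced l)
    (hm : IsReduced m) :
    norm ((mk l)⁻¹ * mk m) + 2 * lcpLength l m = l.length + m.length := by
  induction l generalizing m with
  | nil =>
    rw [inv_mk, mul_mk, norm, toWord_mk]
    simp [lcpLength, hm.reduce_eq]
  | cons a l ih =>
    cases m with
    | nil =>
      rw [inv_mk, mul_mk, norm, toWord_mk, invRev_empty.symm, ← invRev_append, reduce_invRev,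
        List.nil_append, hl.reduce_eq, invRev_length]
      simp [lcpLength, invRev_empty]
    | cons b m =>
      by_cases hab : a = b
      · subst hab
        have := ih (m := m) (List.IsChain.tail hl)
          (List.IsChain.tail hm)
        have key : (mk (a :: l))⁻¹ * mk (a :: m) = (mk l)⁻¹ * mk m := by
          have h (w : List (α × Bool)) : mk (a :: w) = mk [a] * mk w := by
            rw [mul_mk, List.singleton_append]
          rw [h l, h m]
          group
        rw [key]
        simp only [lcpLength, if_true, List.length_cons]
        omega
      · have hred : IsReduced (invRev (a :: l) ++ b :: m) := by
          refine List.IsChain.append ?_ hm ?_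
          · refine IsReduced.of_reduce_eq ?_
            rw [reduce_invRev, hl.reduce_eq]
          · simp only [invRev, List.map_cons, List.reverse_cons, List.getLast?_append,
              List.getLast?_singleton, List.head?_cons, Option.mem_def]
            rintro x hx y hy h
            simp at hx hy
            subst hx hy
            obtain ⟨a1, a2⟩ := a
            obtain ⟨b1, b2⟩ := b
            simp at h hab ⊢
            have := hab h
            cases a2 <;> cases b2 <;> simp_all
        rw [inv_mk, mul_mk, norm, toWord_mk, hred.reduce_eq]
        simp [lcpLength, hab, invRev_length]

/-- The length of the longest common prefix of the reduced words of `x` and `y`. -/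
def lcp (x y : FreeGroup α) : ℕ := lcpLength x.toWord y.toWord

lemma norm_inv_mul_add_lcp (x y : FreeGroup α) :
    norm (x⁻¹ * y) + 2 * lcp x y = norm x + norm y := by
  have h := norm_inv_mul_add_lcpLength (isReduced_toWord (x := x)) (isReduced_toWord (x := y))
  rwa [mk_toWord, mk_toWord] at h

lemma lcp_comm (x y : FreeGroup α) : lcp x y = lcp y x := lcpLength_comm _ _

lemma lcp_le_norm_left (x y : FreeGroup α) : lcp x y ≤ norm x := lcpLength_le_length _ _

lemma min_lcp_le (x y z : FreeGroup α) : min (lcp x y) (lcp y z) ≤ lcp x z :=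
  min_lcpLength_le _ _ _

lemma exists_norm_eq_lcp_eq (x : FreeGroup α) {t : ℕ} (ht : t ≤ norm x) :
    ∃ z : FreeGroup α, norm z = t ∧ lcp z x = t := by
  have hz : (mk (x.toWord.take t)).toWord = x.toWord.take t := by
    rw [toWord_mk]
    exact IsReduced.reduce_eq (List.IsChain.take isReduced_toWord t)
  refine ⟨mk (x.toWord.take t), ?_, ?_⟩
  · rw [norm, hz, List.length_take]
    exact min_eq_left ht
  · rw [lcp, hz]
    exact lcpLength_take _ ht

end FreeGroup

namespace FreeGroup

variable {α : Type*} [DecidableEq α]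

lemma norm_add_two_mul_lcp_mul (h a : FreeGroup α) :
    norm a + 2 * lcp h (h * a) = norm h + norm (h * a) := by
  simpa using norm_inv_mul_add_lcp h (h * a)

lemma eq_of_norm_eq_of_norm_le_lcp {x y : FreeGroup α} (h : norm x = norm y)
    (hxy : norm x ≤ lcp x y) : x = y := by
  have h1 := norm_inv_mul_add_lcp x y
  have h2 : norm (x⁻¹ * y) = 0 := by omega
  exact inv_mul_eq_one.1 (norm_eq_zero.1 h2)

lemma norm_le_lcp_inv_mul {h z a : FreeGroup α} (hz : norm z = lcp h (h * a))
    (hzh : lcp z h = norm z) :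
    norm (h⁻¹ * z) + norm z = norm h ∧ norm (h⁻¹ * z) ≤ lcp (h⁻¹ * z) a := by
  have h1 := norm_inv_mul_add_lcp h z
  have h2 := norm_inv_mul_add_lcp (h⁻¹ * z) a
  have h3 := norm_inv_mul_add_lcp z (h * a)
  have h4 := norm_add_two_mul_lcp_mul h a
  have h5 := min_lcp_le z h (h * a)
  have h6 := lcp_le_norm_left z (h * a)
  rw [show (h⁻¹ * z)⁻¹ * a = z⁻¹ * (h * a) by group] at h2
  rw [lcp_comm h z] at h1
  omega

/-- An element is determined by its length and the position at which right multiplication by a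
given `a` branches off, among elements sharing a prefix of that length. -/
lemma eq_of_lcp_mul_eq {h h' a : FreeGroup α} (ht : lcp h (h * a) = lcp h' (h' * a))
    (hle : lcp h (h * a) ≤ lcp h h') (hn : norm h = norm h') : h = h' := by
  obtain ⟨z, hz, hzh⟩ := exists_norm_eq_lcp_eq h (lcp_le_norm_left h (h * a))
  have hzh' : lcp z h' = norm z := by
    have h1 := min_lcp_le z h h'
    have h2 := lcp_le_norm_left z h'
    omega
  obtain ⟨h1, h2⟩ := norm_le_lcp_inv_mul hz (hzh.trans hz.symm)
  obtain ⟨h3, h4⟩ := norm_le_lcp_inv_mul (hz.trans ht) hzh'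
  have h5 := min_lcp_le (h⁻¹ * z) a (h'⁻¹ * z)
  rw [lcp_comm a] at h5
  have h6 : h⁻¹ * z = h'⁻¹ * z := eq_of_norm_eq_of_norm_le_lcp (by omega) (by omega)
  exact inv_injective (mul_right_cancel h6)

/-- The smallest length at which an element of `h * F` branches off from `h`. -/
noncomputable def branchDepth (F : Finset (FreeGroup α)) (h : FreeGroup α) : ℕ :=
  sInf ((fun a ↦ lcp h (h * a)) '' (F : Set (FreeGroup α)))

/-- No element of `h * F ^ r` branches off from `h` earlier than all elements of `h * F`. -/
def IsStable (F : Finset (FreeGroup α)) (r : ℕ) (h : FreeGroup α) : Prop :=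
  ∀ g ∈ F ^ r, branchDepth F h ≤ lcp h (h * g)

/-- Some element of `h * F ^ θ` is stable. -/
def IsNearStable (F : Finset (FreeGroup α)) (r θ : ℕ) (h : FreeGroup α) : Prop :=
  ∃ f ∈ F ^ θ, IsStable F r (h * f)

variable {F : Finset (FreeGroup α)} {r : ℕ} {h a : FreeGroup α}

lemma branchDepth_le (ha : a ∈ F) : branchDepth F h ≤ lcp h (h * a) :=
  Nat.sInf_le ⟨a, ha, rfl⟩

lemma exists_lcp_eq_branchDepth (hF : (1 : FreeGroup α) ∈ F) (h : FreeGroup α) :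
    ∃ a ∈ F, lcp h (h * a) = branchDepth F h :=
  Nat.sInf_mem (s := (fun a ↦ lcp h (h * a)) '' (F : Set (FreeGroup α))) ⟨_, 1, hF, rfl⟩

lemma exists_of_not_isStable (hF : (1 : FreeGroup α) ∈ F) (hh : ¬ IsStable F r h) :
    ∃ g ∈ F ^ r, (∃ a ∈ F, branchDepth F h + lcp a g = norm h) ∧
      ∀ s ∈ F, norm (h * s) + norm g = norm h + norm (s⁻¹ * g) := by
  simp only [IsStable, not_forall, not_le] at hh
  obtain ⟨g, hg, hlt⟩ := hh
  have key : ∀ s ∈ F, lcp (h * s) (h * g) = lcp h (h * g) := by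
    intro s hs
    have h1 := branchDepth_le (h := h) hs
    have h2 := min_lcp_le (h * s) h (h * g)
    have h3 := min_lcp_le h (h * s) (h * g)
    rw [lcp_comm (h * s) h] at h2
    omega
  have aux : ∀ s : FreeGroup α, norm (s⁻¹ * g) + 2 * lcp (h * s) (h * g) =
      norm (h * s) + norm (h * g) := by
    intro s
    rw [← norm_inv_mul_add_lcp (h * s) (h * g)]
    congr 2
    group
  have h1 := norm_add_two_mul_lcp_mul h g
  refine ⟨g, hg, ?_, ?_⟩
  · obtain ⟨a, ha, hat⟩ := exists_lcp_eq_branchDepth hF h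
    refine ⟨a, ha, ?_⟩
    have h2 := key a ha
    have h3 := aux a
    have h4 := norm_inv_mul_add_lcp a g
    have h5 := norm_add_two_mul_lcp_mul h a
    omega
  · intro s hs
    have h2 := key s hs
    have h3 := aux s
    omega

lemma IsStable.branchDepth_le {ν ν' : FreeGroup α} (hF : (1 : FreeGroup α) ∈ F)
    (hν : IsStable F r ν) {ρ : ℕ} (hρ : ρ + 1 ≤ r) (hf : ν⁻¹ * ν' ∈ F ^ ρ) :
    branchDepth F ν ≤ lcp ν ν' ∧ branchDepth F ν ≤ branchDepth F ν' := by
  have h1 : branchDepth F ν ≤ lcp ν ν' := by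
    simpa using hν _ (Finset.pow_subset_pow_right hF (by omega) hf)
  refine ⟨h1, ?_⟩
  obtain ⟨a, ha, hat⟩ := exists_lcp_eq_branchDepth hF ν'
  have h2 : branchDepth F ν ≤ lcp ν (ν' * a) := by
    have := hν (ν⁻¹ * ν' * a) (Finset.pow_subset_pow_right hF hρ
      (by rw [pow_succ]; exact Finset.mul_mem_mul hf ha))
    rwa [mul_assoc, mul_inv_cancel_left] at this
  have h3 := min_lcp_le ν' ν (ν' * a)
  rw [lcp_comm ν' ν] at h3
  omega

lemma inv_mem_pow (hF : ∀ t ∈ F, t⁻¹ ∈ F) {ρ : ℕ} {f : FreeGroup α} (hf : f ∈ F ^ ρ) :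
    f⁻¹ ∈ F ^ ρ := by
  have h1 : F⁻¹ = F := by
    ext x
    exact ⟨fun hx ↦ inv_inv x ▸ hF _ (Finset.mem_inv'.1 hx),
      fun hx ↦ Finset.mem_inv'.2 (hF _ hx)⟩
  rw [← h1, inv_pow]
  exact Finset.inv_mem_inv hf

lemma IsStable.branchDepth_eq {ν ν' : FreeGroup α} (hF : (1 : FreeGroup α) ∈ F)
    (hF' : ∀ t ∈ F, t⁻¹ ∈ F) (hν : IsStable F r ν) (hν' : IsStable F r ν') {ρ : ℕ}
    (hρ : ρ + 1 ≤ r) (hf : ν⁻¹ * ν' ∈ F ^ ρ) : branchDepth F ν = branchDepth F ν' :=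
  le_antisymm (hν.branchDepth_le hF hρ hf).2
    (hν'.branchDepth_le hF hρ (by simpa using inv_mem_pow hF' hf)).2

/-- The distance from `h` back to the point where `h * F` first branches off. -/
noncomputable def branchHeight (F : Finset (FreeGroup α)) (h : FreeGroup α) : ℤ :=
  (norm h : ℤ) - branchDepth F h

lemma IsStable.branchHeight_eq {ν ν' : FreeGroup α} (hF : (1 : FreeGroup α) ∈ F)
    (hF' : ∀ t ∈ F, t⁻¹ ∈ F) (hν : IsStable F r ν) (hν' : IsStable F r ν') {ρ : ℕ}
    (hρ : ρ + 1 ≤ r) (hf : ν⁻¹ * ν' ∈ F ^ ρ) :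
    branchHeight F ν' = norm (ν⁻¹ * ν') - branchHeight F ν ∨
      ∃ a ∈ F, branchHeight F ν' =
        branchHeight F ν + ((norm ((ν⁻¹ * ν')⁻¹ * a) : ℤ) - norm a) := by
  have h1 := hν.branchDepth_eq hF hF' hν' hρ hf
  obtain ⟨a, ha, hat⟩ := exists_lcp_eq_branchDepth hF ν
  have h2 := (hν.branchDepth_le hF hρ hf).1
  have h3 := norm_inv_mul_add_lcp ν ν'
  have h4 := norm_inv_mul_add_lcp ν' (ν * a)
  have h5 := norm_add_two_mul_lcp_mul ν a
  have h6 := min_lcp_le ν ν' (ν * a)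
  have h7 := min_lcp_le ν' ν (ν * a)
  rw [lcp_comm ν' ν] at h7
  rw [show ν'⁻¹ * (ν * a) = (ν⁻¹ * ν')⁻¹ * a by group] at h4
  simp only [branchHeight]
  by_cases h8 : lcp ν ν' = branchDepth F ν
  · left
    omega
  · right
    refine ⟨a, ha, ?_⟩
    omega

end FreeGroup

/-- The integer combinations of elements of `K` with coefficients at most `j` in absolute value. -/
noncomputable def integerBox (K : Finset ℤ) (j : ℕ) : Finset ℤ :=
  (Fintype.piFinset fun _ : K ↦ Finset.Icc (-(j : ℤ)) j).image fun m ↦ ∑ κ : K, m κ * κ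

section IntegerBox

variable {K : Finset ℤ} {j : ℕ}

lemma mem_integerBox {x : ℤ} :
    x ∈ integerBox K j ↔ ∃ m : K → ℤ, (∀ κ, |m κ| ≤ j) ∧ ∑ κ : K, m κ * κ = x := by
  simp [integerBox, abs_le]

lemma card_integerBox_le (K : Finset ℤ) (j : ℕ) :
    (integerBox K j).card ≤ (2 * j + 1) ^ K.card := by
  refine Finset.card_image_le.trans ?_
  rw [Fintype.card_piFinset]
  simp only [Int.card_Icc, Finset.prod_const, Finset.card_univ, Fintype.card_coe]
  refine Nat.pow_le_pow_left ?_ _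
  omega

lemma zero_mem_integerBox : 0 ∈ integerBox K j :=
  mem_integerBox.2 ⟨0, by simp⟩

lemma integerBox_mono {i : ℕ} (hij : i ≤ j) : integerBox K i ⊆ integerBox K j := by
  intro x hx
  obtain ⟨m, hm, rfl⟩ := mem_integerBox.1 hx
  exact mem_integerBox.2 ⟨m, fun κ ↦ (hm κ).trans (by exact_mod_cast hij), rfl⟩

lemma add_mul_mem_integerBox {x κ e : ℤ} (he : |e| ≤ 1) (hκ : κ ∈ K) (hx : x ∈ integerBox K j) :
    x + e * κ ∈ integerBox K (j + 1) := by
  classical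
  obtain ⟨m, hm, rfl⟩ := mem_integerBox.1 hx
  refine mem_integerBox.2 ⟨m + Pi.single ⟨κ, hκ⟩ e, fun κ' ↦ ?_, ?_⟩
  · rw [Pi.add_apply]
    push_cast
    refine (abs_add_le _ _).trans (add_le_add (hm κ') ?_)
    by_cases h : κ' = ⟨κ, hκ⟩
    · simpa [h] using he
    · simp [h]
  · simp only [Pi.add_apply, add_mul, Finset.sum_add_distrib]
    congr 1
    rw [Finset.sum_eq_single ⟨κ, hκ⟩] <;> simp +contextual

end IntegerBox

lemma exists_lt_le_mul_of_lt_pow {f : ℕ → ℝ} {r : ℝ} (hr : 0 ≤ r) {R : ℕ} (h0 : 1 ≤ f 0)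
    (hR : f R < r ^ R) : ∃ j < R, f (j + 1) ≤ r * f j := by
  by_contra! h
  have key : ∀ j ≤ R, r ^ j ≤ f j := by
    intro j
    induction j with
    | zero => simpa using h0
    | succ j ih =>
      intro hj
      have h1 := mul_le_mul_of_nonneg_left (ih (by omega)) hr
      have h2 := h j (by omega)
      rw [pow_succ']
      linarith
  exact absurd (key R le_rfl) (not_le.2 hR)

/-- A finite set of integers can be partitioned into translates of pieces of a box, so that few
pairs at a prescribed difference are separated. -/
lemma exists_partition_integerBox (K : Finset ℤ) {δ : ℝ} (hδ : 0 ≤ δ) {R : ℕ}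
    (hR : ((integerBox K R).card : ℝ) < (1 + δ) ^ R) (U : Finset ℤ) :
    ∃ f : ℤ → ℤ, (∀ x ∈ U, x - f x ∈ integerBox K R) ∧
      ∀ κ ∈ K, ((U.filter fun x ↦ x + κ ∈ U ∧ f x ≠ f (x + κ)).card : ℝ) ≤
        2 * δ * U.card := by
  induction U using Finset.strongInduction with
  | H U ih =>
  rcases U.eq_empty_or_nonempty with rfl | ⟨a, ha⟩
  · exact ⟨id, by simp⟩
  let Q : ℕ → Finset ℤ := fun j ↦ U.filter fun x ↦ x - a ∈ integerBox K j
  have hQmono {i j : ℕ} (hij : i ≤ j) : Q i ⊆ Q j := by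
    intro x hx
    simp only [Q, Finset.mem_filter] at hx ⊢
    exact ⟨hx.1, integerBox_mono hij hx.2⟩
  have haQ (j : ℕ) : a ∈ Q j := by simp [Q, ha, zero_mem_integerBox]
  obtain ⟨j, hjR, hj⟩ : ∃ j < R, ((Q (j + 1)).card : ℝ) ≤ (1 + δ) * (Q j).card := by
    refine exists_lt_le_mul_of_lt_pow (f := fun j ↦ ((Q j).card : ℝ)) (by linarith) ?_ ?_
    · exact_mod_cast Finset.card_pos.2 ⟨a, haQ 0⟩
    · refine lt_of_le_of_lt ?_ hR
      refine Nat.cast_le.2 (Finset.card_le_card_of_injOn (fun x ↦ x - a) ?_ ?_)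
      · intro x hx
        simp only [Q, Finset.coe_filter, Set.mem_ofPred_eq] at hx
        exact hx.2
      · intro x _ y _ hxy
        simpa using hxy
  have hQU : Q j ⊆ U := Finset.filter_subset _ _
  obtain ⟨f, hf, hfK⟩ := ih (U \ Q j)
    (Finset.sdiff_ssubset hQU ⟨a, haQ j⟩)
  refine ⟨fun x ↦ if x ∈ Q j then a else f x, fun x hx ↦ ?_, fun κ hκ ↦ ?_⟩
  · dsimp only
    split_ifs with h
    · exact integerBox_mono hjR.le (Finset.mem_filter.1 h).2
    · exact hf x (by simp [hx, h])
  · set D := Q (j + 1) \ Q j with hD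
    have hDcard : (D.card : ℝ) ≤ δ * (Q j).card := by
      have h1 : (D.card : ℝ) + (Q j).card = (Q (j + 1)).card := by
        exact_mod_cast Finset.card_sdiff_add_card_eq_card (hQmono (Nat.le_succ j))
      linarith
    have hstep {x e : ℤ} (he : |e| ≤ 1) (hx : x ∈ Q j) (hxU : x + e * κ ∈ U) :
        x + e * κ ∈ Q (j + 1) := by
      refine Finset.mem_filter.2 ⟨hxU, ?_⟩
      rw [add_sub_right_comm]
      exact add_mul_mem_integerBox he hκ (Finset.mem_filter.1 hx).2
    have hsub : (U.filter fun x ↦ x + κ ∈ U ∧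
          (if x ∈ Q j then a else f x) ≠ (if x + κ ∈ Q j then a else f (x + κ))) ⊆
        ((U \ Q j).filter fun x ↦ x + κ ∈ U \ Q j ∧ f x ≠ f (x + κ)) ∪
          (D ∪ D.image fun x ↦ x - κ) := by
      intro x hx
      obtain ⟨hxU, hxκU, hne⟩ := Finset.mem_filter.1 hx
      by_cases h1 : x ∈ Q j
      · by_cases h2 : x + κ ∈ Q j
        · simp [h1, h2] at hne
        · have h3 := hstep (e := 1) (by simp) h1 (by simpa using hxκU)
          rw [one_mul] at h3
          refine Finset.mem_union_right _ (Finset.mem_union_right _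
            (Finset.mem_image.2 ⟨x + κ, Finset.mem_sdiff.2 ⟨h3, h2⟩, by ring⟩))
      · by_cases h2 : x + κ ∈ Q j
        · have h3 := hstep (e := -1) (by simp) h2 (by simpa using hxU)
          rw [show x + κ + -1 * κ = x by ring] at h3
          exact Finset.mem_union_right _ (Finset.mem_union_left _ (Finset.mem_sdiff.2 ⟨h3, h1⟩))
        · refine Finset.mem_union_left _ (Finset.mem_filter.2 ?_)
          simp only [h1, h2, if_false] at hne
          simp [hxU, hxκU, h1, h2, hne]
    have h1 := (Finset.card_le_card hsub).trans ((Finset.card_union_le _ _).trans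
      (Nat.add_le_add_left ((Finset.card_union_le _ _).trans
        (Nat.add_le_add_left Finset.card_image_le _)) _))
    have h2 := hfK κ hκ
    have h3 : ((U \ Q j).card : ℝ) + (Q j).card = U.card := by
      exact_mod_cast Finset.card_sdiff_add_card_eq_card hQU
    refine (Nat.cast_le.2 h1).trans ?_
    push_cast
    rw [← h3]
    linarith

lemma exists_pow_lt_one_add_pow (M : ℕ) {δ : ℝ} (hδ : 0 < δ) :
    ∃ R : ℕ, ((2 * R + 1) ^ M : ℝ) < (1 + δ) ^ R := by
  have h1 := tendsto_pow_const_div_const_pow_of_one_lt M (r := 1 + δ) (by linarith)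
  have h2 := h1.eventually_lt_const (u := ((3 : ℝ) ^ M)⁻¹) (by positivity)
  obtain ⟨R, hR, hR1⟩ := (h2.and (Filter.eventually_ge_atTop 1)).exists
  refine ⟨R, ?_⟩
  rw [div_lt_iff₀ (by positivity), inv_mul_eq_div, lt_div_iff₀ (by positivity), ← mul_pow] at hR
  refine lt_of_le_of_lt ?_ hR
  have : (1 : ℝ) ≤ R := by exact_mod_cast hR1
  gcongr
  linarith

lemma card_filter_Ico_add_notMem_le (q : ℕ) (κ : ℤ) :
    (((Finset.Ico (0 : ℤ) q).filter fun x ↦ x + κ ∉ Finset.Ico (0 : ℤ) q).card : ℤ) ≤ |κ| := by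
  have hsub : ((Finset.Ico (0 : ℤ) q).filter fun x ↦ x + κ ∉ Finset.Ico (0 : ℤ) q) ⊆
      Finset.Ico 0 (-κ) ∪ Finset.Ico (q - κ) q := by
    intro x hx
    simp only [Finset.mem_filter, Finset.mem_Ico, Finset.mem_union] at hx ⊢
    omega
  have h := (Finset.card_le_card hsub).trans (Finset.card_union_le _ _)
  simp only [Int.card_Ico] at h
  rcases abs_cases κ with ⟨h1, _⟩ | ⟨h1, _⟩ <;> rw [h1] <;> omega

/-- Random partitions of the integers into pieces of bounded size, which separate with small
probability any two points whose difference is in a prescribed finite set. The bound on the size of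
the pieces depends only on the cardinality of that set. -/
lemma exists_random_partition (M : ℕ) {ε : ℝ} (hε : 0 < ε) :
    ∃ P : ℕ, ∀ K : Finset ℤ, K.card ≤ M →
      ∃ (q : ℕ) (_ : NeZero q) (c : ZMod q → ℤ → ℤ),
        (∀ ω a, ∃ A : Finset ℤ, A.card ≤ P ∧ ∀ i, c ω i = a → i ∈ A) ∧
        ∀ κ ∈ K, ∀ i, ((Finset.univ.filter fun ω ↦ c ω i ≠ c ω (i + κ)).card : ℝ) ≤ ε * q := by
  obtain ⟨R, hR⟩ := exists_pow_lt_one_add_pow M (δ := ε / 3) (by positivity)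
  refine ⟨(2 * R + 1) ^ M, fun K hK ↦ ?_⟩
  have hcard : (integerBox K R).card ≤ (2 * R + 1) ^ M :=
    (card_integerBox_le K R).trans (Nat.pow_le_pow_right (by omega) hK)
  obtain ⟨q, hq0, hq⟩ : ∃ q : ℕ, q ≠ 0 ∧ ∀ κ ∈ K, (|κ| : ℝ) ≤ ε / 3 * q := by
    have h1 : ∀ κ ∈ K, ∀ᶠ q : ℕ in Filter.atTop, (|κ| : ℝ) ≤ ε / 3 * q := fun κ _ ↦
      (tendsto_natCast_atTop_atTop.const_mul_atTop (by positivity : 0 < ε / 3)).eventually_ge_atTop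
        _
    obtain ⟨q, hq, hq1⟩ := (((Filter.eventually_all_finset K).2 h1).and
      (Filter.eventually_ge_atTop 1)).exists
    exact ⟨q, by omega, hq⟩
  have : NeZero q := ⟨hq0⟩
  set U := Finset.Ico (0 : ℤ) q with hU
  obtain ⟨f, hf, hfK⟩ := exists_partition_integerBox K (δ := ε / 3) (by positivity)
    (lt_of_le_of_lt (by exact_mod_cast hcard) hR) U
  let p : ZMod q → ℤ → ℤ := fun ω i ↦ ((i + ω : ZMod q).val : ℤ)
  have hpU (ω i) : p ω i ∈ U := by
    simp only [p, hU, Finset.mem_Ico]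
    exact ⟨by positivity, by exact_mod_cast ZMod.val_lt _⟩
  have hp (ω) (i κ : ℤ) (h : p ω i + κ ∈ U) : p ω (i + κ) = p ω i + κ := by
    have h1 : ((i + κ : ℤ) + ω : ZMod q) = ((p ω i + κ : ℤ) : ZMod q) := by
      simp [p]
      ring
    simp only [hU, Finset.mem_Ico] at h
    change (((i + κ : ℤ) + ω : ZMod q).val : ℤ) = _
    rw [h1, ZMod.val_intCast]
    exact Int.emod_eq_of_lt h.1 h.2
  refine ⟨q, inferInstance, fun ω i ↦ i - (p ω i - f (p ω i)), fun ω a ↦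
    ⟨(integerBox K R).image fun x ↦ a + x, Finset.card_image_le.trans hcard, ?_⟩, ?_⟩
  · rintro i rfl
    exact Finset.mem_image.2 ⟨_, hf _ (hpU ω i), by ring⟩
  · intro κ hκ i
    have hcount : (Finset.univ.filter fun ω ↦ i - (p ω i - f (p ω i)) ≠
        i + κ - (p ω (i + κ) - f (p ω (i + κ)))).card ≤
        ((U.filter fun x ↦ x + κ ∉ U) ∪
          (U.filter fun x ↦ x + κ ∈ U ∧ f x ≠ f (x + κ))).card := by
      refine Finset.card_le_card_of_injOn (fun ω ↦ p ω i) ?_ ?_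
      · intro ω hω
        have hne := (Finset.mem_filter.1 (Finset.mem_coe.1 hω)).2
        by_cases h : p ω i + κ ∈ U
        · refine Finset.mem_coe.2 (Finset.mem_union_right _
            (Finset.mem_filter.2 ⟨hpU ω i, h, fun heq ↦ hne ?_⟩))
          rw [hp ω i κ h, ← heq]
          ring
        · exact Finset.mem_coe.2 (Finset.mem_union_left _ (Finset.mem_filter.2 ⟨hpU ω i, h⟩))
      · intro ω _ ω' _ h
        exact add_left_cancel (ZMod.val_injective q (Nat.cast_injective h))
    have h1 := hcount.trans (Finset.card_union_le _ _)
    have h2 : (((U.filter fun x ↦ x + κ ∉ U).card : ℤ) : ℝ) ≤ (|κ| : ℤ) :=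
      Int.cast_le.2 (card_filter_Ico_add_notMem_le q κ)
    have h3 := hfK κ hκ
    have h4 := hq κ hκ
    have h5 : (U.card : ℝ) = q := by simp [hU]
    rw [h5] at h3
    push_cast at h2
    refine (Nat.cast_le.2 h1).trans ?_
    push_cast
    linarith

lemma List.length_le_countP_mul {β : Type*} (p : β → Prop) [DecidablePred p] (L : ℕ) (l : List β)
    (hl : ∀ l', l' <:+: l → (∀ x ∈ l', ¬ p x) → l'.length ≤ L) :
    l.length ≤ (l.countP p + 1) * (L + 1) := by
  induction hn : l.length using Nat.strong_induction_on generalizing l with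
  | _ n ih =>
  subst hn
  have hsplit := List.takeWhile_append_dropWhile (p := fun x ↦ !decide (p x)) (l := l)
  have htake : (l.takeWhile fun x ↦ !decide (p x)).length ≤ L := by
    refine hl _ (List.takeWhile_prefix _).isInfix fun x hx ↦ ?_
    simpa using List.mem_takeWhile_imp hx
  rcases hd : l.dropWhile (fun x ↦ !decide (p x)) with _ | ⟨x, l₂⟩
  · rw [hd, List.append_nil] at hsplit
    rw [hsplit] at htake
    nlinarith
  · have hx : p x := by
      have h := List.head_dropWhile_not (fun x ↦ !decide (p x)) (l := l) (by simp [hd])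
      simpa [hd] using h
    rw [hd] at hsplit
    generalize l.takeWhile (fun x ↦ !decide (p x)) = l₁ at hsplit htake
    subst hsplit
    have h2 := ih l₂.length (by simp; omega) l₂ (fun l' hl' ↦ hl l' (hl'.trans
      ((List.suffix_cons x l₂).isInfix.trans (List.suffix_append l₁ (x :: l₂)).isInfix))) rfl
    have h3 : l₂.countP p + 1 ≤ (l₁ ++ x :: l₂).countP p := by
      simp [List.countP_append, hx]
    simp only [List.length_append, List.length_cons]
    nlinarith

lemma List.Nodup.length_le_card_of_forall {β γ : Type*} {l : List β} (hl : l.Nodup) {D : Finset γ}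
    (φ : β → γ) (hφ : ∀ x ∈ l, φ x ∈ D) (hinj : ∀ x ∈ l, ∀ y ∈ l, φ x = φ y → x = y) :
    l.length ≤ D.card := by
  classical
  rw [← List.toFinset_card_of_nodup hl]
  exact Finset.card_le_card_of_injOn φ (by simpa [Set.MapsTo] using hφ)
    (fun x hx y hy ↦ hinj x (by simpa using hx) y (by simpa using hy))

/-- A bound for the number of steps of a simple path in a free group which stays in an annulus of
prescribed size. -/
def chainBound (n P : ℕ) : ℕ → ℕ
  | 0 => 0
  | k + 1 => (n * P + 1) * (chainBound n P k + 1)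

lemma chainBound_mono (n P : ℕ) : Monotone (chainBound n P) := by
  refine monotone_nat_of_le_succ fun k ↦ ?_
  rw [chainBound]
  nlinarith [Nat.zero_le (n * P * (chainBound n P k + 1))]

namespace FreeGroup

variable {α : Type*} [DecidableEq α] {F : Finset (FreeGroup α)} {r : ℕ}

lemma isTrans_le_lcp (t : ℕ) : IsTrans (FreeGroup α) fun x y ↦ t ≤ lcp x y :=
  ⟨fun x y z hxy hyz ↦ (le_min hxy hyz).trans (min_lcp_le x y z)⟩

lemma length_le_chainBound (hF : (1 : FreeGroup α) ∈ F) {N : Finset ℕ} {P : ℕ} (hP : N.card ≤ P)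
    (T : Finset ℕ) {l : List (FreeGroup α)} (hl : l.IsChain fun x y ↦ x⁻¹ * y ∈ F)
    (hnd : l.Nodup) (hN : ∀ x ∈ l, norm x ∈ N) (hT : ∀ x ∈ l, branchDepth F x ∈ T) :
    l.length ≤ chainBound F.card P T.card := by
  induction T using Finset.induction_on_min generalizing l with
  | empty =>
    cases l with
    | nil => simp
    | cons x l => simpa using hT x (by simp)
  | insert t T ht ih =>
    have htT : t ∉ T := fun h ↦ lt_irrefl _ (ht t h)
    have hmin : ∀ x ∈ l, t ≤ branchDepth F x := by
      intro x hx
      rcases Finset.mem_insert.1 (hT x hx) with h | h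
      · exact h.ge
      · exact (ht _ h).le
    choose a ha hat using exists_lcp_eq_branchDepth hF
    have hpair : l.Pairwise fun x y ↦ t ≤ lcp x y := by
      have := isTrans_le_lcp (α := α) t
      refine List.IsChain.pairwise ?_
      refine List.IsChain.imp_of_mem_imp ?_ hl
      intro x y hx _ hxy
      have := branchDepth_le (h := x) hxy
      rw [mul_inv_cancel_left] at this
      exact (hmin x hx).trans this
    have hcount : l.countP (fun x ↦ branchDepth F x = t) ≤ F.card * P := by
      rw [List.countP_eq_length_filter]
      refine (List.Nodup.length_le_card_of_forall (D := F ×ˢ N) (hnd.filter _)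
        (fun x ↦ (a x, norm x)) ?_ ?_).trans ?_
      · intro x hx
        exact Finset.mem_product.2 ⟨ha x, hN x (List.mem_of_mem_filter hx)⟩
      · intro x hx y hy hxy
        obtain ⟨hxl, hxt⟩ := List.mem_filter.1 hx
        obtain ⟨hyl, hyt⟩ := List.mem_filter.1 hy
        simp only [decide_eq_true_eq] at hxt hyt
        simp only [Prod.mk.injEq] at hxy
        by_contra hne
        have hle : t ≤ lcp x y := by
          have : Std.Symm fun x y : FreeGroup α ↦ t ≤ lcp x y :=
            ⟨fun x y h ↦ h.trans_eq (lcp_comm x y)⟩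
          exact hpair.forall hxl hyl hne
        have hx1 := hat x
        have hy1 := hat y
        rw [← hxy.1] at hy1
        exact hne (eq_of_lcp_mul_eq (a := a x) (by omega) (by omega) hxy.2)
      · rw [Finset.card_product]
        exact Nat.mul_le_mul_left _ hP
    rw [Finset.card_insert_of_notMem htT, chainBound]
    refine (List.length_le_countP_mul (fun x ↦ branchDepth F x = t) _ l ?_).trans
      (Nat.mul_le_mul_right _ (Nat.succ_le_succ hcount))
    intro l' hl' hl't
    have hl'' : l'.IsChain fun x y ↦ x⁻¹ * y ∈ F := by
      obtain ⟨l₁, l₂, rfl⟩ := hl'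
      exact hl.left_of_append.right_of_append
    refine ih hl'' (hnd.sublist hl'.sublist) (fun x hx ↦ hN x (hl'.subset hx)) ?_
    intro x hx
    exact (Finset.mem_insert.1 (hT x (hl'.subset hx))).resolve_left (hl't x hx)

lemma inv_mul_mem_pow (hF : ∀ t ∈ F, t⁻¹ ∈ F) {θ : ℕ} {x y ν ν' : FreeGroup α}
    (hxy : x⁻¹ * y ∈ F) (hx : x⁻¹ * ν ∈ F ^ θ) (hy : y⁻¹ * ν' ∈ F ^ θ) :
    ν⁻¹ * ν' ∈ F ^ (2 * θ + 1) := by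
  have h1 : ν⁻¹ * ν' = (x⁻¹ * ν)⁻¹ * (x⁻¹ * y) * (y⁻¹ * ν') := by group
  rw [h1, show 2 * θ + 1 = θ + 1 + θ by ring, pow_add, pow_add, pow_one]
  exact Finset.mul_mem_mul (Finset.mul_mem_mul (inv_mem_pow hF hx) hxy) hy

lemma length_le_of_isStable (hF : (1 : FreeGroup α) ∈ F) (hF' : ∀ t ∈ F, t⁻¹ ∈ F) {θ : ℕ}
    (hθ : 2 * θ + 2 ≤ r) (ν : FreeGroup α → FreeGroup α) {A : Finset ℤ}
    {l : List (FreeGroup α)} (hl : l.IsChain fun x y ↦ x⁻¹ * y ∈ F) (hnd : l.Nodup)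
    (hν : ∀ x ∈ l, x⁻¹ * ν x ∈ F ^ θ) (hst : ∀ x ∈ l, IsStable F r (ν x))
    (hA : ∀ x ∈ l, branchHeight F (ν x) ∈ A) :
    l.length ≤ F.card * A.card * F.card ^ θ := by
  choose a ha hat using exists_lcp_eq_branchDepth hF
  have hpair : l.Pairwise fun x y ↦ branchDepth F (ν x) = branchDepth F (ν y) ∧
      branchDepth F (ν x) ≤ lcp (ν x) (ν y) := by
    have : IsTrans (FreeGroup α) fun x y ↦ branchDepth F (ν x) = branchDepth F (ν y) ∧
        branchDepth F (ν x) ≤ lcp (ν x) (ν y) := by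
      refine ⟨fun x y z hxy hyz ↦ ⟨hxy.1.trans hyz.1, ?_⟩⟩
      have := min_lcp_le (ν x) (ν y) (ν z)
      omega
    refine List.IsChain.pairwise ?_
    refine List.IsChain.imp_of_mem_imp ?_ hl
    intro x y hx hy hxy
    have h := inv_mul_mem_pow hF' hxy (hν x hx) (hν y hy)
    exact ⟨(hst x hx).branchDepth_eq hF hF' (hst y hy) hθ h,
      ((hst x hx).branchDepth_le hF hθ h).1⟩
  refine (hnd.length_le_card_of_forall (D := (F ×ˢ A) ×ˢ (F ^ θ))
    (fun x ↦ ((a (ν x), branchHeight F (ν x)), x⁻¹ * ν x)) ?_ ?_).trans ?_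
  · intro x hx
    exact Finset.mem_product.2 ⟨Finset.mem_product.2 ⟨ha _, hA x hx⟩, hν x hx⟩
  · intro x hx y hy hxy
    simp only [Prod.mk.injEq] at hxy
    obtain ⟨⟨h1, h2⟩, h3⟩ := hxy
    by_contra hne
    have : Std.Symm fun x y : FreeGroup α ↦ branchDepth F (ν x) = branchDepth F (ν y) ∧
        branchDepth F (ν x) ≤ lcp (ν x) (ν y) :=
      ⟨fun x y h ↦ ⟨h.1.symm, h.1 ▸ h.2.trans_eq (lcp_comm _ _)⟩⟩
    obtain ⟨h4, h5⟩ := hpair.forall hx hy hne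
    have hx1 := hat (ν x)
    have hy1 := hat (ν y)
    rw [← h1] at hy1
    have hνxy : ν x = ν y := by
      refine eq_of_lcp_mul_eq (a := a (ν x)) (by omega) (by omega) ?_
      simp only [branchHeight] at h2
      omega
    rw [hνxy] at h3
    exact hne (inv_injective (mul_right_cancel h3))
  · rw [Finset.card_product, Finset.card_product]
    exact Nat.mul_le_mul_left _ Finset.card_pow_le

end FreeGroup

section EmpiricalMeasure

variable {Ω Γ : Type*} [Fintype Ω] [DecidableEq Γ]

lemma sum_abs_ite_sub_ite_le (S : Finset Γ) (a b : Γ) :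
    ∑ t ∈ S, |(if a = t then (1 : ℝ) else 0) - (if b = t then 1 else 0)| ≤
      if a = b then 0 else 2 := by
  split_ifs with hab
  · simp [hab]
  · have hle (t : Γ) : |(if a = t then (1 : ℝ) else 0) - (if b = t then 1 else 0)| ≤
        (if a = t then (1 : ℝ) else 0) + (if b = t then 1 else 0) := by
      split_ifs <;> norm_num
    refine (Finset.sum_le_sum fun t _ ↦ hle t).trans ?_
    rw [Finset.sum_add_distrib, Finset.sum_ite_eq, Finset.sum_ite_eq]
    split_ifs <;> norm_num

lemma finsum_card_filter_div [Nonempty Ω] (u : Ω → Γ) :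
    ∑ᶠ t, ((Finset.univ.filter fun ω ↦ u ω = t).card : ℝ) / Fintype.card Ω = 1 := by
  rw [finsum_eq_sum_of_support_subset (s := Finset.univ.image u)]
  · rw [← Finset.sum_div, ← Nat.cast_sum, ← Finset.card_eq_sum_card_image, Finset.card_univ]
    exact div_self (by positivity)
  · intro t ht
    by_contra h
    refine ht ?_
    dsimp only
    rw [Finset.filter_eq_empty_iff.2]
    · simp
    · rintro ω - rfl
      exact h (by simp)

lemma finsum_abs_card_filter_sub_le (u v : Ω → Γ) :
    ∑ᶠ t, |((Finset.univ.filter fun ω ↦ u ω = t).card : ℝ) / Fintype.card Ω -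
        ((Finset.univ.filter fun ω ↦ v ω = t).card : ℝ) / Fintype.card Ω| ≤
      2 * (Finset.univ.filter fun ω ↦ u ω ≠ v ω).card / Fintype.card Ω := by
  rw [finsum_eq_sum_of_support_subset (s := Finset.univ.image u ∪ Finset.univ.image v)]
  · simp only [← sub_div, abs_div, Nat.abs_cast, ← Finset.sum_div]
    refine div_le_div_of_nonneg_right ?_ (by positivity)
    simp only [Finset.card_filter, Nat.cast_sum, Nat.cast_ite, Nat.cast_one, Nat.cast_zero,
      ← Finset.sum_sub_distrib, Finset.mul_sum]
    refine (Finset.sum_le_sum fun t _ ↦ Finset.abs_sum_le_sum_abs _ _).trans ?_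
    rw [Finset.sum_comm]
    refine Finset.sum_le_sum fun ω _ ↦ (sum_abs_ite_sub_ite_le _ _ _).trans_eq ?_
    by_cases h : u ω = v ω <;> simp [h]
  · intro t ht
    by_contra h
    refine ht ?_
    simp only [Finset.coe_union, Finset.coe_image, Finset.coe_univ, Set.image_univ,
      Set.mem_union, Set.mem_range, not_or, not_exists] at h
    simp [h.1, h.2]

end EmpiricalMeasure

/-- A random colouring of a group, for which monochromatic simple paths are short and neighbours
rarely get different colours, yields functions as in the definition of uniform exactness. -/
lemma exists_almost_invariant_of_colouring {Γ Ω C : Type*} [Group Γ] [Fintype Ω] [Nonempty Ω]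
    [DecidableEq C] {F : Finset Γ} (hF : (1 : Γ) ∈ F) (hF' : ∀ t ∈ F, t⁻¹ ∈ F)
    (col : Ω → Γ → C) {L : ℕ}
    (hlen : ∀ ω (l : List Γ), (l.IsChain fun x y ↦ x⁻¹ * y ∈ F ∧ col ω x = col ω y) →
      l.Nodup → l.length ≤ L)
    (hcut : ∀ h, ∀ s ∈ F, 2 * (F.card : ℝ) ^ 2 *
      (Finset.univ.filter fun ω ↦ col ω h ≠ col ω (h * s)).card ≤ Fintype.card Ω) :
    ∃ η : Γ → Γ → ℝ,
      (∀ x t, 0 ≤ η x t) ∧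
      (∀ x, Function.support (η x) ⊆ (F : Set Γ) ^ L) ∧
      (∀ x, ∑ᶠ t, η x t = 1) ∧
      (∑ s ∈ F, ⨆ x : Γ, ∑ᶠ t, |η (s * x) t - η x (s⁻¹ * t)|) ≤ 1 / (F.card : ℝ) := by
  classical
  let G : Ω → SimpleGraph Γ := fun ω ↦
    { Adj := fun x y ↦ x ≠ y ∧ x⁻¹ * y ∈ F ∧ col ω x = col ω y
      symm := ⟨fun x y h ↦ ⟨h.1.symm, by simpa using hF' _ h.2.1, h.2.2.symm⟩⟩
      loopless := ⟨fun x h ↦ h.1 rfl⟩ }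
  have hwalk (ω) {x y : Γ} (p : (G ω).Walk x y) : x⁻¹ * y ∈ (F : Set Γ) ^ p.length := by
    induction p with
    | nil => simp
    | @cons u v w h p ih =>
      rw [SimpleGraph.Walk.length_cons, pow_succ', show u⁻¹ * w = u⁻¹ * v * (v⁻¹ * w) by group]
      exact Set.mul_mem_mul h.2.1 ih
  let rep : Ω → Γ → Γ := fun ω x ↦ ((G ω).connectedComponentMk x).out
  have hrep (ω x) : x⁻¹ * rep ω x ∈ (F : Set Γ) ^ L := by
    have hreach : (G ω).Reachable x (rep ω x) :=
      (SimpleGraph.ConnectedComponent.exact (Quot.out_eq ((G ω).connectedComponentMk x))).symm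
    obtain ⟨p, hp⟩ := hreach.exists_isPath
    have h1 := hlen ω p.support (p.isChain_adj_support.imp fun x y h ↦ h.2) hp.support_nodup
    rw [SimpleGraph.Walk.length_support] at h1
    exact Set.pow_subset_pow_right (by exact_mod_cast hF) (by omega) (hwalk ω p)
  have hrepeq (ω x) {s : Γ} (hs : s ∈ F) (h : col ω x = col ω (x * s)) :
      rep ω x = rep ω (x * s) := by
    by_cases hx : x = x * s
    · rw [← hx]
    · have hadj : (G ω).Adj x (x * s) := ⟨hx, by simpa using hs, h⟩
      exact congrArg Quot.out (SimpleGraph.ConnectedComponent.sound hadj.reachable)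
  refine ⟨fun x t ↦ ((Finset.univ.filter fun ω ↦ x * rep ω x⁻¹ = t).card : ℝ) / Fintype.card Ω,
    fun x t ↦ by positivity, fun x t ht ↦ ?_, fun x ↦ finsum_card_filter_div _, ?_⟩
  · have hne : (Finset.univ.filter fun ω ↦ x * rep ω x⁻¹ = t).Nonempty := by
      rw [Finset.nonempty_iff_ne_empty]
      intro h
      simp [h] at ht
    obtain ⟨ω, hω⟩ := hne
    rw [← (Finset.mem_filter.1 hω).2]
    simpa using hrep ω x⁻¹
  · have hn : (0 : ℝ) < F.card := by exact_mod_cast Finset.card_pos.2 ⟨1, hF⟩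
    have hN : (0 : ℝ) < Fintype.card Ω := by positivity
    have key : ∀ s ∈ F, (⨆ x : Γ, ∑ᶠ t,
        |((Finset.univ.filter fun ω ↦ s * x * rep ω (s * x)⁻¹ = t).card : ℝ) / Fintype.card Ω -
          ((Finset.univ.filter fun ω ↦ x * rep ω x⁻¹ = s⁻¹ * t).card : ℝ) / Fintype.card Ω|) ≤
        1 / (F.card : ℝ) ^ 2 := by
      intro s hs
      refine ciSup_le fun x ↦ ?_
      simp only [eq_inv_mul_iff_mul_eq]
      refine (finsum_abs_card_filter_sub_le _ _).trans ?_
      have hsub : (Finset.univ.filter fun ω ↦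
          s * x * rep ω (s * x)⁻¹ ≠ s * (x * rep ω x⁻¹)).card ≤
          (Finset.univ.filter fun ω ↦ col ω x⁻¹ ≠ col ω (x⁻¹ * s⁻¹)).card := by
        refine Finset.card_le_card (Finset.monotone_filter_right _ fun ω _ hne heq ↦ hne ?_)
        rw [mul_inv_rev, ← hrepeq ω x⁻¹ (hF' s hs) heq, mul_assoc]
      have h1 := hcut x⁻¹ s⁻¹ (hF' s hs)
      have h2 : ((Finset.univ.filter fun ω ↦
          s * x * rep ω (s * x)⁻¹ ≠ s * (x * rep ω x⁻¹)).card : ℝ) ≤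
          (Finset.univ.filter fun ω ↦ col ω x⁻¹ ≠ col ω (x⁻¹ * s⁻¹)).card := by
        exact_mod_cast hsub
      rw [div_le_div_iff₀ hN (by positivity)]
      nlinarith [mul_le_mul_of_nonneg_left h2 (by positivity : 0 ≤ 2 * (F.card : ℝ) ^ 2)]
    refine (Finset.sum_le_sum key).trans_eq ?_
    rw [Finset.sum_const, nsmul_eq_mul]
    field_simp

namespace FreeGroup

variable {α : Type*} [DecidableEq α] {F : Finset (FreeGroup α)} {r : ℕ}

lemma IsNearStable.mono {θ θ' : ℕ} {x s : FreeGroup α} (hF : (1 : FreeGroup α) ∈ F)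
    (hF' : ∀ t ∈ F, t⁻¹ ∈ F) (hs : s ∈ F) (hx : IsNearStable F r θ x) (hθ : θ < θ') :
    IsNearStable F r θ' (x * s) := by
  obtain ⟨f, hf, hst⟩ := hx
  refine ⟨s⁻¹ * f, Finset.pow_subset_pow_right hF hθ ?_, by simpa [mul_assoc] using hst⟩
  rw [pow_succ']
  exact Finset.mul_mem_mul (hF' s hs) hf

/-- Whether or not `h` is near stable changes along an edge for at most one scale. -/
lemma eq_of_not_isNearStable_iff {θ θ' : ℕ} {x s : FreeGroup α} (hF : (1 : FreeGroup α) ∈ F)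
    (hF' : ∀ t ∈ F, t⁻¹ ∈ F) (hs : s ∈ F)
    (h : ¬ (IsNearStable F r θ x ↔ IsNearStable F r θ (x * s)))
    (h' : ¬ (IsNearStable F r θ' x ↔ IsNearStable F r θ' (x * s))) : θ = θ' := by
  by_contra hne
  wlog hlt : θ < θ' generalizing θ θ'
  · exact this h' h (Ne.symm hne) (by omega)
  refine h' ?_
  have hor : IsNearStable F r θ x ∨ IsNearStable F r θ (x * s) := by tauto
  rcases hor with hx | hx
  · refine ⟨fun _ ↦ hx.mono hF hF' hs hlt, fun _ ↦ ?_⟩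
    simpa using hx.mono hF hF' hF hlt
  · refine ⟨fun _ ↦ ?_, fun _ ↦ ?_⟩
    · simpa using hx.mono hF hF' hF hlt
    · simpa using hx.mono hF hF' (hF' s hs) hlt

lemma IsStable.isNearStable {θ : ℕ} {x : FreeGroup α} (hF : (1 : FreeGroup α) ∈ F)
    (hx : IsStable F r x) : IsNearStable F r θ x :=
  ⟨1, by simpa using Finset.pow_subset_pow_right hF (Nat.zero_le θ) (Finset.one_mem_one),
    by simpa using hx⟩

/-- The differences of levels occurring between neighbours. -/
def levelShifts (F : Finset (FreeGroup α)) (r : ℕ) : Finset ℤ :=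
  ((F ^ r).image fun f ↦ (norm f : ℤ)) ∪
    ((((F ^ r) ×ˢ F).image fun p ↦ (norm (p.1⁻¹ * p.2) : ℤ) - norm p.2) ∪
      ((F ×ˢ (F ^ r)).image fun p ↦ (norm (p.1⁻¹ * p.2) : ℤ) - norm p.2))

lemma card_levelShifts_le (F : Finset (FreeGroup α)) (r : ℕ) :
    (levelShifts F r).card ≤
      F.card ^ r + (F.card ^ r * F.card + F.card * F.card ^ r) := by
  refine (Finset.card_union_le _ _).trans (Nat.add_le_add ?_
    ((Finset.card_union_le _ _).trans (Nat.add_le_add ?_ ?_)))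
  · exact Finset.card_image_le.trans Finset.card_pow_le
  · refine Finset.card_image_le.trans ?_
    rw [Finset.card_product]
    exact Nat.mul_le_mul_right _ Finset.card_pow_le
  · refine Finset.card_image_le.trans ?_
    rw [Finset.card_product]
    exact Nat.mul_le_mul_left _ Finset.card_pow_le

lemma IsStable.exists_mem_levelShifts {ν ν' : FreeGroup α} (hF : (1 : FreeGroup α) ∈ F)
    (hF' : ∀ t ∈ F, t⁻¹ ∈ F) (hν : IsStable F r ν) (hν' : IsStable F r ν') {ρ : ℕ}
    (hρ : ρ + 1 ≤ r) (hf : ν⁻¹ * ν' ∈ F ^ ρ) :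
    ∃ κ ∈ levelShifts F r, branchHeight F ν' = κ - branchHeight F ν ∨
      branchHeight F ν' = branchHeight F ν + κ := by
  have hfr : ν⁻¹ * ν' ∈ F ^ r := Finset.pow_subset_pow_right hF (by omega) hf
  rcases hν.branchHeight_eq hF hF' hν' hρ hf with h | ⟨a, ha, h⟩
  · exact ⟨_, Finset.mem_union_left _ (Finset.mem_image.2 ⟨_, hfr, rfl⟩), Or.inl h⟩
  · exact ⟨_, Finset.mem_union_right _ (Finset.mem_union_left _ (Finset.mem_image.2
      ⟨(_, a), Finset.mem_product.2 ⟨hfr, ha⟩, rfl⟩)), Or.inr h⟩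

lemma exists_norm_mul_eq_of_not_isStable {x s : FreeGroup α} (hF : (1 : FreeGroup α) ∈ F)
    (hx : ¬ IsStable F r x) (hs : s ∈ F) :
    ∃ κ ∈ levelShifts F r, (norm (x * s) : ℤ) = norm x + κ := by
  obtain ⟨g, hg, -, h⟩ := exists_of_not_isStable hF hx
  refine ⟨(norm (s⁻¹ * g) : ℤ) - norm g, Finset.mem_union_right _ (Finset.mem_union_right _
    (Finset.mem_image.2 ⟨(s, g), Finset.mem_product.2 ⟨hs, hg⟩, rfl⟩)), ?_⟩
  have := h s hs
  omega

end FreeGroup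

/-- Reflecting a level does not change its symmetrised class. -/
lemma card_sym2_ne_le {Ω : Type*} [Fintype Ω] {c : Ω → ℤ → ℤ} {B : ℝ} {κ : ℤ}
    (hc : ∀ i, ((Finset.univ.filter fun ω ↦ c ω i ≠ c ω (i + κ)).card : ℝ) ≤ B) {i i' : ℤ}
    (hi : i' = κ - i ∨ i' = i + κ) :
    ((Finset.univ.filter fun ω ↦ s(c ω i, c ω (-i)) ≠ s(c ω i', c ω (-i'))).card : ℝ) ≤
      2 * B := by
  classical
  have key (j j' : ℤ) (h : ∀ ω, c ω j = c ω (j + κ) → c ω j' = c ω (j' + κ) →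
      s(c ω i, c ω (-i)) = s(c ω i', c ω (-i'))) :
      ((Finset.univ.filter fun ω ↦ s(c ω i, c ω (-i)) ≠ s(c ω i', c ω (-i'))).card : ℝ) ≤
        2 * B := by
    have hsub : (Finset.univ.filter fun ω ↦ s(c ω i, c ω (-i)) ≠ s(c ω i', c ω (-i'))) ⊆
        (Finset.univ.filter fun ω ↦ c ω j ≠ c ω (j + κ)) ∪
          (Finset.univ.filter fun ω ↦ c ω j' ≠ c ω (j' + κ)) := by
      intro ω hω
      by_contra hn
      simp only [Finset.mem_union, Finset.mem_filter, Finset.mem_univ, true_and, not_or,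
        not_not] at hn
      exact (Finset.mem_filter.1 hω).2 (h ω hn.1 hn.2)
    have h1 : ((Finset.univ.filter fun ω ↦
        s(c ω i, c ω (-i)) ≠ s(c ω i', c ω (-i'))).card : ℝ) ≤
        (Finset.univ.filter fun ω ↦ c ω j ≠ c ω (j + κ)).card +
          (Finset.univ.filter fun ω ↦ c ω j' ≠ c ω (j' + κ)).card := by
      exact_mod_cast (Finset.card_le_card hsub).trans (Finset.card_union_le _ _)
    linarith [hc j, hc j']
  rcases hi with rfl | rfl
  · refine key (-i) (i - κ) fun ω h1 h2 ↦ ?_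
    rw [neg_add_eq_sub] at h1
    rw [sub_add_cancel] at h2
    rw [neg_sub, h1, h2, Sym2.eq_swap]
  · refine key i (-(i + κ)) fun ω h1 h2 ↦ ?_
    rw [show -(i + κ) + κ = -i by ring] at h2
    rw [h1, h2]

lemma List.IsChain.forall_eq_of_mem {β C : Type*} {f : β → C} {l : List β}
    (hl : l.IsChain fun x y ↦ f x = f y) : ∀ x ∈ l, ∀ y ∈ l, f x = f y := by
  have : IsTrans β fun x y ↦ f x = f y := ⟨fun _ _ _ h h' ↦ h.trans h'⟩
  have : Std.Symm fun x y : β ↦ f x = f y := ⟨fun _ _ h ↦ h.symm⟩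
  intro x hx y hy
  exact List.Pairwise.forall_of_forall (R := fun x y ↦ f x = f y) (fun _ _ ↦ rfl) hl.pairwise
    hx hy

namespace FreeGroup

variable {α : Type*} [DecidableEq α] {F : Finset (FreeGroup α)} {r : ℕ}

open Classical in
/-- A stable element of `h * F ^ θ`, if there is one. -/
noncomputable def stableNeighbour (F : Finset (FreeGroup α)) (r θ : ℕ) (h : FreeGroup α) :
    FreeGroup α :=
  if H : IsNearStable F r θ h then h * H.choose else 1

lemma IsNearStable.stableNeighbour_mem {θ : ℕ} {h : FreeGroup α} (H : IsNearStable F r θ h) :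
    h⁻¹ * stableNeighbour F r θ h ∈ F ^ θ := by
  simpa [stableNeighbour, H] using H.choose_spec.1

lemma IsNearStable.isStable_stableNeighbour {θ : ℕ} {h : FreeGroup α}
    (H : IsNearStable F r θ h) : IsStable F r (stableNeighbour F r θ h) := by
  simpa [stableNeighbour, H] using H.choose_spec.2

open Classical in
/-- The colour of a group element induced by a colouring `c` of the levels: near stable elements
are coloured by the symmetrised height above the branching point of a stable neighbour, the other
ones by their length. -/
noncomputable def colour (F : Finset (FreeGroup α)) (r θ : ℕ) (c : ℤ → ℤ) (h : FreeGroup α) :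
    Sym2 ℤ ⊕ ℤ :=
  if IsNearStable F r θ h then
    Sum.inl s(c (branchHeight F (stableNeighbour F r θ h)),
      c (-branchHeight F (stableNeighbour F r θ h)))
  else Sum.inr (c (norm h))

lemma length_le_of_colour_eq (hF : (1 : FreeGroup α) ∈ F) (hF' : ∀ t ∈ F, t⁻¹ ∈ F) {θ : ℕ}
    (hθ : 2 * θ + 2 ≤ r) {c : ℤ → ℤ} {P : ℕ}
    (hc : ∀ a, ∃ A : Finset ℤ, A.card ≤ P ∧ ∀ i, c i = a → i ∈ A) {l : List (FreeGroup α)}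
    (hl : l.IsChain fun x y ↦ x⁻¹ * y ∈ F ∧ colour F r θ c x = colour F r θ c y)
    (hnd : l.Nodup) :
    l.length ≤ F.card * (2 * P) * F.card ^ r +
      chainBound F.card P (P * (F.card * F.card ^ r)) := by
  have hn : 0 < F.card := Finset.card_pos.2 ⟨1, hF⟩
  rcases l.eq_nil_or_concat with rfl | ⟨l₀, z, hl₀⟩
  · simp
  have hz : z ∈ l := by simp [hl₀]
  have hcol : ∀ x ∈ l, colour F r θ c x = colour F r θ c z := fun x hx ↦
    (hl.imp fun _ _ h ↦ h.2).forall_eq_of_mem x hx z hz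
  have hl' : l.IsChain fun x y ↦ x⁻¹ * y ∈ F := hl.imp fun _ _ h ↦ h.1
  by_cases hnear : IsNearStable F r θ z
  · have hx_near : ∀ x ∈ l, IsNearStable F r θ x := by
      intro x hx
      by_contra hx'
      simpa [colour, hnear, hx'] using hcol x hx
    obtain ⟨A, hAP, hA⟩ := hc (c (branchHeight F (stableNeighbour F r θ z)))
    obtain ⟨B, hBP, hB⟩ := hc (c (-branchHeight F (stableNeighbour F r θ z)))
    have hAB : (A ∪ B).card ≤ 2 * P := (Finset.card_union_le _ _).trans (by omega)
    have h1 := length_le_of_isStable hF hF' hθ (stableNeighbour F r θ) (A := A ∪ B) hl' hnd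
      (fun x hx ↦ (hx_near x hx).stableNeighbour_mem)
      (fun x hx ↦ (hx_near x hx).isStable_stableNeighbour) (by
        intro x hx
        have h := hcol x hx
        simp only [colour, hnear, hx_near x hx, if_true, Sum.inl.injEq, Sym2.eq_iff] at h
        rcases h with h | h
        · exact Finset.mem_union_left _ (hA _ h.1)
        · exact Finset.mem_union_right _ (hB _ h.1))
    refine (h1.trans ?_).trans (Nat.le_add_right _ _)
    exact Nat.mul_le_mul (Nat.mul_le_mul_left _ hAB) (Nat.pow_le_pow_right hn (by omega))
  · have hx_far : ∀ x ∈ l, ¬ IsNearStable F r θ x := by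
      intro x hx hx'
      simpa [colour, hnear, hx'] using hcol x hx
    obtain ⟨A, hAP, hA⟩ := hc (c (norm z))
    have hAc : (A.image Int.toNat).card ≤ P := Finset.card_image_le.trans hAP
    have hnorm : ∀ x ∈ l, norm x ∈ A.image Int.toNat := by
      intro x hx
      have h := hcol x hx
      simp only [colour, hnear, hx_far x hx, if_false, Sum.inr.injEq] at h
      exact Finset.mem_image.2 ⟨_, hA _ h, by simp⟩
    let T : Finset ℕ := ((A.image Int.toNat) ×ˢ (F ×ˢ (F ^ r))).image
      fun p ↦ p.1 - lcp p.2.1 p.2.2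
    have hT : T.card ≤ P * (F.card * F.card ^ r) := by
      refine Finset.card_image_le.trans ?_
      rw [Finset.card_product, Finset.card_product]
      exact Nat.mul_le_mul hAc (Nat.mul_le_mul_left _ Finset.card_pow_le)
    have h1 := length_le_chainBound hF hAc T hl' hnd hnorm (by
      intro x hx
      obtain ⟨g, hg, ⟨a, ha, h⟩, -⟩ :=
        exists_of_not_isStable hF fun h ↦ hx_far x hx (h.isNearStable hF)
      refine Finset.mem_image.2 ⟨(norm x, a, g), ?_, ?_⟩
      · exact Finset.mem_product.2 ⟨hnorm x hx, Finset.mem_product.2 ⟨ha, hg⟩⟩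
      · dsimp only
        omega)
    exact (h1.trans (chainBound_mono _ _ hT)).trans (Nat.le_add_left _ _)

lemma card_colour_ne_le {Ω : Type*} [Fintype Ω] (hF : (1 : FreeGroup α) ∈ F)
    (hF' : ∀ t ∈ F, t⁻¹ ∈ F) {θ : ℕ} (hθ : 2 * θ + 2 ≤ r) {c : Ω → ℤ → ℤ} {B : ℝ} (hB : 0 ≤ B)
    (hc : ∀ κ ∈ levelShifts F r, ∀ i,
      ((Finset.univ.filter fun ω ↦ c ω i ≠ c ω (i + κ)).card : ℝ) ≤ B)
    {x s : FreeGroup α} (hs : s ∈ F)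
    (h : IsNearStable F r θ x ↔ IsNearStable F r θ (x * s)) :
    ((Finset.univ.filter fun ω ↦
      colour F r θ (c ω) x ≠ colour F r θ (c ω) (x * s)).card : ℝ) ≤ 2 * B := by
  by_cases hx : IsNearStable F r θ x
  · have hy := h.1 hx
    obtain ⟨κ, hκ, hi⟩ := hx.isStable_stableNeighbour.exists_mem_levelShifts hF hF'
      hy.isStable_stableNeighbour hθ (inv_mul_mem_pow hF' (by simpa using hs)
        hx.stableNeighbour_mem hy.stableNeighbour_mem)
    simpa [colour, hx, hy] using card_sym2_ne_le (hc κ hκ) hi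
  · have hy := mt h.2 hx
    obtain ⟨κ, hκ, hi⟩ := exists_norm_mul_eq_of_not_isStable hF
      (fun h ↦ hx (h.isNearStable hF)) hs
    have h1 := hc κ hκ (norm x)
    rw [← hi] at h1
    have h2 : ((Finset.univ.filter fun ω ↦
        colour F r θ (c ω) x ≠ colour F r θ (c ω) (x * s)).card : ℝ) ≤ B := by
      simpa [colour, hx, hy] using h1
    linarith

/-- Averaging over the scale `θ` makes neighbours get different colours with small probability. -/
lemma sum_card_colour_ne_le {Ω : Type*} [Fintype Ω] (hF : (1 : FreeGroup α) ∈ F)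
    (hF' : ∀ t ∈ F, t⁻¹ ∈ F) {K : ℕ} (hK : 2 * K ≤ r) {c : Ω → ℤ → ℤ} {B : ℝ} (hB : 0 ≤ B)
    (hc : ∀ κ ∈ levelShifts F r, ∀ i,
      ((Finset.univ.filter fun ω ↦ c ω i ≠ c ω (i + κ)).card : ℝ) ≤ B)
    {x s : FreeGroup α} (hs : s ∈ F) :
    ((Finset.univ.filter fun p : Fin K × Ω ↦
      colour F r p.1 (c p.2) x ≠ colour F r p.1 (c p.2) (x * s)).card : ℝ) ≤
        Fintype.card Ω + K * (2 * B) := by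
  classical
  have hsum : (Finset.univ.filter fun p : Fin K × Ω ↦
      colour F r p.1 (c p.2) x ≠ colour F r p.1 (c p.2) (x * s)).card =
      ∑ θ : Fin K, (Finset.univ.filter fun ω ↦
        colour F r θ (c ω) x ≠ colour F r θ (c ω) (x * s)).card := by
    simp only [Finset.card_filter, Fintype.sum_prod_type]
  let D : Finset (Fin K) := Finset.univ.filter fun θ ↦
    ¬ (IsNearStable F r θ x ↔ IsNearStable F r θ (x * s))
  have hD : D.card ≤ 1 := by
    refine Finset.card_le_one.2 fun θ hθ θ' hθ' ↦ Fin.ext ?_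
    exact eq_of_not_isNearStable_iff hF hF' hs (Finset.mem_filter.1 hθ).2
      (Finset.mem_filter.1 hθ').2
  have hle (θ : Fin K) : ((Finset.univ.filter fun ω ↦
      colour F r θ (c ω) x ≠ colour F r θ (c ω) (x * s)).card : ℝ) ≤
      (if θ ∈ D then (Fintype.card Ω : ℝ) else 0) + 2 * B := by
    split_ifs with h
    · have : ((Finset.univ.filter fun ω ↦
          colour F r θ (c ω) x ≠ colour F r θ (c ω) (x * s)).card : ℝ) ≤ Fintype.card Ω := by
        exact_mod_cast Finset.card_le_univ _
      linarith
    · rw [zero_add]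
      refine card_colour_ne_le hF hF' (by omega) hB hc hs ?_
      by_contra hn
      exact h (Finset.mem_filter.2 ⟨Finset.mem_univ _, hn⟩)
  rw [hsum, Nat.cast_sum]
  refine (Finset.sum_le_sum fun θ _ ↦ hle θ).trans ?_
  rw [Finset.sum_add_distrib, Finset.sum_ite_mem, Finset.univ_inter, Finset.sum_const,
    Finset.sum_const, Finset.card_univ, Fintype.card_fin, nsmul_eq_mul, nsmul_eq_mul]
  have hD' : (D.card : ℝ) ≤ 1 := by exact_mod_cast hD
  nlinarith [mul_le_mul_of_nonneg_right hD' (Nat.cast_nonneg (α := ℝ) (Fintype.card Ω))]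

end FreeGroup

/-- Free groups are uniformly exact, with a common modulus of uniform exactness. -/
theorem freeGroups_uniformlyExact :
    ∃ k : ℕ → ℕ, ∀ α : Type*, IsUEModulus k (FreeGroup α) := by
  classical
  have hP (n : ℕ) := exists_random_partition
    (n ^ (8 * n ^ 2) + (n ^ (8 * n ^ 2) * n + n * n ^ (8 * n ^ 2)))
    (ε := 1 / (8 * ((n : ℝ) + 1) ^ 2)) (by positivity)
  choose P hP using hP
  refine ⟨fun n ↦ n * (2 * P n) * n ^ (8 * n ^ 2) +
    chainBound n (P n) (P n * (n * n ^ (8 * n ^ 2))), fun α F hF hF' ↦ ?_⟩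
  obtain ⟨q, _, c, hc, hcut⟩ := hP F.card (FreeGroup.levelShifts F (8 * F.card ^ 2))
    (FreeGroup.card_levelShifts_le F _)
  have hn : 0 < F.card := Finset.card_pos.2 ⟨1, hF⟩
  have : NeZero (4 * F.card ^ 2) := ⟨by positivity⟩
  refine exists_almost_invariant_of_colouring (Ω := Fin (4 * F.card ^ 2) × ZMod q) hF hF'
    (fun p ↦ FreeGroup.colour F (8 * F.card ^ 2) p.1 (c p.2)) ?_ ?_
  · intro p l hl hnd
    exact FreeGroup.length_le_of_colour_eq hF hF' (by omega) (hc p.2) hl hnd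
  · intro x s hs
    have h1 := FreeGroup.sum_card_colour_ne_le (r := 8 * F.card ^ 2) (K := 4 * F.card ^ 2)
      hF hF' (by omega) (by positivity) hcut (x := x) hs
    have hn' : (0 : ℝ) < F.card := by exact_mod_cast hn
    have hq : (0 : ℝ) ≤ q := by positivity
    rw [Fintype.card_prod, Fintype.card_fin, ZMod.card]
    rw [ZMod.card] at h1
    push_cast at h1 ⊢
    refine (mul_le_mul_of_nonneg_left h1 (by positivity)).trans ?_
    have h2 : 4 * (F.card : ℝ) ^ 2 * (2 * (1 / (8 * ((F.card : ℝ) + 1) ^ 2) * q)) ≤ q := by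
      rw [show 4 * (F.card : ℝ) ^ 2 * (2 * (1 / (8 * ((F.card : ℝ) + 1) ^ 2) * q)) =
        (F.card : ℝ) ^ 2 * q / ((F.card : ℝ) + 1) ^ 2 by field_simp; ring]
      rw [div_le_iff₀ (by positivity)]
      nlinarith [mul_nonneg hn'.le hq]
    nlinarith [sq_nonneg (F.card : ℝ)]
end

section
/- Finitely generated free groups have tame geometry at infinity. Precisely: let G = FreeGroup β be a free group on a finite set β, with word length ℓ given by the length of the reduced word (FreeGroup.norm). For every d ∈ ℕ there exists r ∈ ℕ (one may take r = 3d + 1) such that for all elements g₁, …, g_{r+1} of the free group F_d on d generators there exists a constant C > 0 such that every group homomorphism π : F_d → G admits two distinct indices i ≠ j with ℓ(π(g_i)) ≤ C·ℓ(π(g_j)) and ℓ(π(g_j)) ≤ C·ℓ(π(g_i)). -/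
open Polynomial LaurentPolynomial in
/-- If a polynomial vanishes at Laurent polynomials whose lowest terms have exponents `-n i`, then
two of its monomials have the same weight with respect to `n`. -/
theorem MvPolynomial.exists_ne_weight_eq_of_aeval_eq_zero {ι k : Type*} [Fintype ι] [Field k]
    {P : MvPolynomial ι k} (hP : P ≠ 0) (n : ι → ℕ) (u : ι → k[X])
    (hu : ∀ i, (u i).eval 0 ≠ 0)
    (h : MvPolynomial.aeval (fun i => (T (-(n i : ℤ)) * toLaurent (u i) : k[T;T⁻¹])) P = 0) :
    ∃ a ∈ P.support, ∃ b ∈ P.support, a ≠ b ∧ ∑ i, a i * n i = ∑ i, b i * n i := by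
  by_contra! hne
  obtain ⟨m, hm, hmax⟩ := P.support.exists_max_image (fun a => ∑ i, a i * n i)
    (MvPolynomial.support_nonempty.2 hP)
  set w : (ι →₀ ℕ) → ℕ := fun a => ∑ i, a i * n i with hw
  set Q : k[X] := ∑ a ∈ P.support,
    Polynomial.C (P.coeff a) * (Polynomial.X ^ (w m - w a) * ∏ i, u i ^ a i) with hQ
  have hQ0 : Q = 0 := by
    apply Polynomial.toLaurent_injective
    have hscaled := congrArg (fun z => T (w m : ℤ) * z) h
    simp only [MvPolynomial.aeval_def, MvPolynomial.eval₂_eq', Finset.mul_sum, mul_zero]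
      at hscaled
    rw [hQ, map_sum, map_zero, ← hscaled]
    refine Finset.sum_congr rfl fun a ha => ?_
    have hT : ∏ i, (T (-(n i : ℤ)) : k[T;T⁻¹]) ^ a i = T (-(w a : ℤ)) := by
      rw [hw]
      push_cast
      rw [← Finset.sum_neg_distrib]
      induction (Finset.univ : Finset ι) using Finset.cons_induction with
      | empty => simp
      | cons i s hi ih => rw [Finset.prod_cons, ih, Finset.sum_cons, T_add, T_pow, mul_neg]
    rw [Finset.prod_congr rfl fun i _ => mul_pow _ _ _, Finset.prod_mul_distrib, hT]
    rw [_root_.map_mul, _root_.map_mul, toLaurent_X_pow, toLaurent_C, map_prod,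
      Nat.cast_sub (hmax a ha), T_sub, LaurentPolynomial.algebraMap_apply]
    simp only [map_pow]
    simp only [Algebra.algebraMap_self, RingHom.id_apply]
    ring
  have hev := congrArg (Polynomial.eval 0) hQ0
  rw [hQ, Polynomial.eval_finsetSum, Finset.sum_eq_single m, Polynomial.eval_zero] at hev
  · simp only [tsub_self, pow_zero, one_mul, Polynomial.eval_mul, Polynomial.eval_C,
      Polynomial.eval_prod, Polynomial.eval_pow] at hev
    exact mul_ne_zero (MvPolynomial.mem_support_iff.1 hm)
      (Finset.prod_ne_zero_iff.2 fun i _ => pow_ne_zero _ (hu i)) hev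
  · intro a ha ham
    have hlt : w a < w m := lt_of_le_of_ne (hmax a ha) (hne a ha m hm ham)
    simp [Nat.sub_ne_zero_of_lt hlt]
  · exact fun hm' => absurd hm hm'

/-- Positive integers satisfying a nontrivial linear relation with coefficients bounded by `D`
contain two that are comparable up to a constant depending only on `D` and their number. -/
theorem exists_ne_comparable_of_sum_mul_eq {ι : Type*} [Fintype ι] {e a b : ι → ℕ} {D : ℕ}
    (he : ∀ i, 0 < e i) (ha : ∀ i, a i ≤ D) (hb : ∀ i, b i ≤ D) (hab : a ≠ b)
    (h : ∑ i, a i * e i = ∑ i, b i * e i) :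
    ∃ i j, i ≠ j ∧ e i ≤ (Fintype.card ι * D + 1) * e j ∧
      e j ≤ (Fintype.card ι * D + 1) * e i := by
  classical
  obtain ⟨i₀, hi₀⟩ := Function.ne_iff.1 hab
  obtain ⟨i, hi, hmax⟩ := ({i | a i ≠ b i} : Finset ι).exists_max_image e ⟨i₀, by simpa⟩
  simp only [Finset.mem_filter, Finset.mem_univ, true_and] at hi hmax
  set C := Fintype.card ι * D + 1 with hC
  by_contra! hne
  have hsmall : ∀ j, j ≠ i → a j ≠ b j → C * e j < e i := by
    intro j hji hj
    by_contra! hle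
    have := hne i j hji.symm hle
    have := hmax j hj
    nlinarith
  have hzero : ∑ j, ((a j : ℤ) - b j) * e j = 0 := by
    simp only [sub_mul, Finset.sum_sub_distrib]
    exact_mod_cast sub_eq_zero.2 (congrArg (Nat.cast : ℕ → ℤ) h)
  rw [← Finset.add_sum_erase _ _ (Finset.mem_univ i)] at hzero
  have hle : (C : ℤ) * e i ≤ ∑ j ∈ Finset.univ.erase i, (D : ℤ) * e i := by
    calc (C : ℤ) * e i ≤ C * |((a i : ℤ) - b i) * e i| := by
          rw [abs_mul, Nat.abs_cast]
          have : 1 ≤ |(a i : ℤ) - b i| :=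
            Int.one_le_abs (sub_ne_zero.2 (by exact_mod_cast hi))
          gcongr
          exact le_mul_of_one_le_left (by positivity) this
      _ = C * |∑ j ∈ Finset.univ.erase i, ((a j : ℤ) - b j) * e j| := by
          rw [eq_neg_of_add_eq_zero_left hzero, abs_neg]
      _ ≤ C * ∑ j ∈ Finset.univ.erase i, |((a j : ℤ) - b j) * e j| := by
          gcongr
          exact Finset.abs_sum_le_sum_abs _ _
      _ ≤ ∑ j ∈ Finset.univ.erase i, (D : ℤ) * e i := by
          rw [Finset.mul_sum]
          refine Finset.sum_le_sum fun j hj => ?_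
          rw [abs_mul, Nat.abs_cast]
          by_cases hj' : a j = b j
          · simp only [hj', sub_self, abs_zero, zero_mul, mul_zero]
            positivity
          · have h₁ : (C : ℤ) * e j ≤ e i := by
              exact_mod_cast (hsmall j (Finset.ne_of_mem_erase hj) hj').le
            have h₂ : |(a j : ℤ) - b j| ≤ D := by
              have := ha j
              have := hb j
              rw [abs_le]
              omega
            calc (C : ℤ) * (|(a j : ℤ) - b j| * e j) = |(a j : ℤ) - b j| * (C * e j) := by ring
              _ ≤ D * e i := by gcongr
  rw [Finset.sum_const, nsmul_eq_mul] at hle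
  have hcard : ((Finset.univ.erase i).card : ℤ) ≤ Fintype.card ι := by
    exact_mod_cast Finset.card_le_univ _
  have hpos : (0 : ℤ) < e i := by exact_mod_cast he i
  have hmul : ((Finset.univ.erase i).card : ℤ) * (D * e i) ≤ Fintype.card ι * (D * e i) := by
    gcongr
  rw [hC] at hle
  push_cast at hle
  linarith

namespace FreeGroup

open Polynomial LaurentPolynomial Matrix

variable {α : Type*}

/-- The projection of the plane onto the line through `(1, x a)` along the line through
`(1, x a⁻¹)`, for a letter `a`. -/
def letterProj (x : α × Bool → ℚ) (a : α × Bool) : Matrix (Fin 2) (Fin 2) ℚ :=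
  (x (a.1, !a.2) - x a)⁻¹ •
    !![x (a.1, !a.2), -1; x a * x (a.1, !a.2), -x a]

/-- The polynomial matrix whose reduction at `0` is the projection of a letter. -/
noncomputable def letterPoly (x : α × Bool → ℚ) (a : α × Bool) : Matrix (Fin 2) (Fin 2) ℚ[X] :=
  (letterProj x a).map Polynomial.C +
    (Polynomial.X ^ 2 : ℚ[X]) • (letterProj x (a.1, !a.2)).map Polynomial.C

/-- The matrix of determinant one acting by `T⁻¹` on the line of a letter and by `T` on the line
of its inverse. -/
noncomputable def letterMatrix (x : α × Bool → ℚ) (a : α × Bool) :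
    Matrix (Fin 2) (Fin 2) ℚ[T;T⁻¹] :=
  (T (-1) : ℚ[T;T⁻¹]) • (letterPoly x a).map toLaurent

theorem letterProj_mulVec {x : α × Bool → ℚ} (a : α × Bool) (z : ℚ) :
    letterProj x a *ᵥ ![1, z] =
      ((x (a.1, !a.2) - z) / (x (a.1, !a.2) - x a)) • ![1, x a] := by
  ext i
  fin_cases i <;> simp [letterProj, Matrix.mulVec, dotProduct, Fin.sum_univ_two] <;> ring

theorem ne_letter_inv (a : α × Bool) : (a.1, !a.2) ≠ a := by
  intro h
  simpa using congrArg Prod.snd h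

theorem letterProj_mul_self {x : α × Bool → ℚ} (hx : Function.Injective x) (a : α × Bool) :
    letterProj x a * letterProj x a = letterProj x a := by
  have hd : x (a.1, !a.2) - x a ≠ 0 := sub_ne_zero.2 (hx.ne (ne_letter_inv a))
  ext i j
  fin_cases i <;> fin_cases j <;> simp [letterProj, Matrix.mul_apply, Fin.sum_univ_two] <;>
    field_simp <;> ring

theorem letterProj_mul_inv (x : α × Bool → ℚ) (a : α × Bool) :
    letterProj x a * letterProj x (a.1, !a.2) = 0 := by
  ext i j
  fin_cases i <;> fin_cases j <;> simp [letterProj, Matrix.mul_apply, Fin.sum_univ_two] <;> ring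

theorem letterProj_add_inv {x : α × Bool → ℚ} (hx : Function.Injective x) (a : α × Bool) :
    letterProj x a + letterProj x (a.1, !a.2) = 1 := by
  have hd : x (a.1, !a.2) - x a ≠ 0 := sub_ne_zero.2 (hx.ne (ne_letter_inv a))
  have hd' : (x a - x (a.1, !a.2))⁻¹ = -(x (a.1, !a.2) - x a)⁻¹ := by
    rw [← inv_neg, neg_sub]
  ext i j
  fin_cases i <;> fin_cases j <;> simp [letterProj, hd'] <;> field_simp <;> ring

theorem letterPoly_mul_inv {x : α × Bool → ℚ} (hx : Function.Injective x) (a : α × Bool) :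
    letterPoly x a * letterPoly x (a.1, !a.2) = (Polynomial.X ^ 2 : ℚ[X]) • 1 := by
  have hinv := letterProj_mul_inv x (a.1, !a.2)
  have hself := letterProj_mul_self hx (a.1, !a.2)
  simp only [Bool.not_not, Prod.mk.eta] at hinv hself
  simp only [letterPoly, Bool.not_not, Prod.mk.eta, ← RingHom.mapMatrix_apply, add_mul, mul_add,
    Matrix.smul_mul, Matrix.mul_smul, ← _root_.map_mul, hinv, hself, letterProj_mul_inv,
    letterProj_mul_self hx, map_zero, smul_zero, zero_add, add_zero]
  rw [← smul_add, ← map_add, add_comm, letterProj_add_inv hx, _root_.map_one]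

theorem letterMatrix_mul_inv {x : α × Bool → ℚ} (hx : Function.Injective x) (a : α × Bool) :
    letterMatrix x a * letterMatrix x (a.1, !a.2) = 1 := by
  rw [letterMatrix, letterMatrix, Matrix.smul_mul, Matrix.mul_smul, smul_smul,
    ← Matrix.map_mul, letterPoly_mul_inv hx]
  ext i j
  simp only [Matrix.smul_apply, Matrix.map_apply, smul_eq_mul, _root_.map_mul, toLaurent_X_pow,
    ← mul_assoc, ← T_add]
  fin_cases i <;> fin_cases j <;> simp

/-- The Schottky representation of a free group over Laurent polynomials. -/
noncomputable def schottky {x : α × Bool → ℚ} (hx : Function.Injective x) :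
    FreeGroup α →* (Matrix (Fin 2) (Fin 2) ℚ[T;T⁻¹])ˣ :=
  lift fun b => ⟨letterMatrix x (b, true), letterMatrix x (b, false),
    letterMatrix_mul_inv hx (b, true), letterMatrix_mul_inv hx (b, false)⟩

theorem schottky_eq_prod [DecidableEq α] {x : α × Bool → ℚ} (hx : Function.Injective x)
    (w : FreeGroup α) :
    (schottky hx w : Matrix (Fin 2) (Fin 2) ℚ[T;T⁻¹]) =
      (w.toWord.map (letterMatrix x)).prod := by
  conv_lhs => rw [← w.mk_toWord, schottky, lift_mk]
  rw [← Units.coeHom_apply, map_list_prod, List.map_map]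
  congr 2
  ext1 ⟨b, s⟩
  cases s <;> rfl

theorem prod_letterMatrix (x : α × Bool → ℚ) (L : List (α × Bool)) :
    (L.map (letterMatrix x)).prod =
      (T (-(L.length : ℤ)) : ℚ[T;T⁻¹]) • ((L.map (letterPoly x)).prod).map toLaurent := by
  induction L with
  | nil => simp
  | cons a L ih =>
    rw [List.map_cons, List.prod_cons, ih, letterMatrix, List.map_cons, List.prod_cons,
      Matrix.smul_mul, Matrix.mul_smul, smul_smul, ← T_add, Matrix.map_mul, List.length_cons]
    congr 2
    push_cast
    ring

theorem map_eval_prod_letterPoly (x : α × Bool → ℚ) (L : List (α × Bool)) :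
    ((L.map (letterPoly x)).prod).map (Polynomial.evalRingHom 0) =
      (L.map (letterProj x)).prod := by
  rw [← RingHom.mapMatrix_apply, map_list_prod, List.map_map]
  congr 2
  ext a i j
  simp [letterPoly]

theorem prod_letterProj_mulVec {x : α × Bool → ℚ} (hx : Function.Injective x)
    (hx0 : ∀ a, x a ≠ 0) {L : List (α × Bool)} (hL : IsReduced L) :
    ∃ c : ℚ, c ≠ 0 ∧
      (L.map (letterProj x)).prod *ᵥ ![1, 0] = c • ![1, (L.head?.map x).getD 0] := by
  induction L with
  | nil => exact ⟨1, one_ne_zero, by simp⟩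
  | cons a L ih =>
    obtain ⟨c, hc, h⟩ := ih hL.tail
    have hd : x (a.1, !a.2) - x a ≠ 0 := sub_ne_zero.2 (hx.ne (ne_letter_inv a))
    refine ⟨c * ((x (a.1, !a.2) - (L.head?.map x).getD 0) / (x (a.1, !a.2) - x a)),
      mul_ne_zero hc (div_ne_zero (sub_ne_zero.2 ?_) hd), ?_⟩
    · cases L with
      | nil => simpa using hx0 _
      | cons b L =>
        simp only [List.head?_cons, Option.map_some, Option.getD_some]
        refine hx.ne fun hab => ?_
        have hred := (List.isChain_cons_cons.1 hL).1
        subst hab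
        simpa using hred rfl
    · rw [List.map_cons, List.prod_cons, ← Matrix.mulVec_mulVec, h, Matrix.mulVec_smul,
        letterProj_mulVec, smul_smul]
      rfl

/-- The upper left entry of the Schottky representation has its pole of order exactly the word
length. -/
theorem exists_schottky_apply_eq [DecidableEq α] {x : α × Bool → ℚ} (hx : Function.Injective x)
    (hx0 : ∀ a, x a ≠ 0) (w : FreeGroup α) :
    ∃ u : ℚ[X], u.eval 0 ≠ 0 ∧
      (schottky hx w : Matrix (Fin 2) (Fin 2) ℚ[T;T⁻¹]) 0 0 =
        T (-(w.norm : ℤ)) * toLaurent u := by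
  refine ⟨(w.toWord.map (letterPoly x)).prod 0 0, ?_, ?_⟩
  · obtain ⟨c, hc, h⟩ := prod_letterProj_mulVec hx hx0 w.isReduced_toWord
    rw [← map_eval_prod_letterPoly] at h
    have h₀ := congrFun h 0
    simp [Matrix.mulVec, dotProduct, Fin.sum_univ_two] at h₀
    rwa [h₀]
  · rw [schottky_eq_prod, prod_letterMatrix]
    rfl

/-- The product of generic matrices along the reduced word of an element. -/
noncomputable def genericMatrix [DecidableEq α] (w : FreeGroup α) :
    Matrix (Fin 2) (Fin 2) (MvPolynomial ((α × Bool) × Fin 2 × Fin 2) ℚ) :=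
  (w.toWord.map fun a => Matrix.of fun i j => MvPolynomial.X (a, i, j)).prod

theorem map_aeval_genericMatrix [DecidableEq α] {A : Type*} [CommRing A] [Algebra ℚ A]
    (ρ : FreeGroup α →* (Matrix (Fin 2) (Fin 2) A)ˣ) (w : FreeGroup α) :
    (genericMatrix w).map (MvPolynomial.aeval fun v =>
        (ρ (mk [v.1]) : Matrix (Fin 2) (Fin 2) A) v.2.1 v.2.2) = ρ w := by
  rw [genericMatrix, ← AlgHom.mapMatrix_apply, map_list_prod, List.map_map]
  conv_rhs => rw [← w.mk_toWord]
  induction w.toWord with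
  | nil => simp [← one_eq_mk]
  | cons a L ih =>
    have hmk : (mk (a :: L) : FreeGroup α) = mk [a] * mk L := by simp [mul_mk]
    rw [List.map_cons, List.prod_cons, ih, hmk, _root_.map_mul, Units.val_mul]
    congr 1
    ext i j
    simp

theorem exists_comparable_norm_of_ne_one {ι β : Type*} [Fintype ι] [Fintype α] [DecidableEq α]
    [Countable β] [DecidableEq β] (hι : 8 * Fintype.card α < Fintype.card ι)
    (g : ι → FreeGroup α) :
    ∃ C : ℕ, ∀ π : FreeGroup α →* FreeGroup β, (∀ i, π (g i) ≠ 1) →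
      ∃ i j, i ≠ j ∧ norm (π (g i)) ≤ C * norm (π (g j)) ∧
        norm (π (g j)) ≤ C * norm (π (g i)) := by
  have hdep : ¬ AlgebraicIndependent ℚ fun i => genericMatrix (g i) 0 0 := by
    intro hind
    have hle := hind.lift_cardinalMk_le_trdeg
    rw [MvPolynomial.trdeg_of_isDomain] at hle
    simp only [Cardinal.mk_fintype, Cardinal.lift_natCast, Nat.cast_le, Fintype.card_prod,
      Fintype.card_bool, Fintype.card_fin] at hle
    omega
  rw [algebraicIndependent_iff] at hdep
  push Not at hdep
  obtain ⟨P, hP, hP0⟩ := hdep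
  obtain ⟨f, hf⟩ := exists_injective_nat (β × Bool)
  set x : β × Bool → ℚ := fun a => f a + 1 with hxdef
  have hx : Function.Injective x := fun a b hab => hf (by simpa [hxdef] using hab)
  have hx0 : ∀ a, x a ≠ 0 := fun a => by positivity
  refine ⟨Fintype.card ι * P.totalDegree + 1, fun π hπ => ?_⟩
  choose u hu huw using fun w => exists_schottky_apply_eq hx hx0 w
  have hvan : MvPolynomial.aeval (fun i =>
      (T (-(norm (π (g i)) : ℤ)) * toLaurent (u (π (g i))) : ℚ[T;T⁻¹])) P = 0 := by
    have := congrArg (MvPolynomial.aeval fun v =>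
        (((schottky hx).comp π (mk [v.1]) : (Matrix (Fin 2) (Fin 2) ℚ[T;T⁻¹])ˣ) :
          Matrix (Fin 2) (Fin 2) ℚ[T;T⁻¹]) v.2.1 v.2.2) hP
    rw [map_zero, ← AlgHom.comp_apply, MvPolynomial.comp_aeval] at this
    rw [← this]
    congr 2
    ext1 i
    rw [← huw]
    exact (congrFun₂ (map_aeval_genericMatrix ((schottky hx).comp π) (g i)) 0 0).symm
  obtain ⟨a, ha, b, hb, hab, hsum⟩ := MvPolynomial.exists_ne_weight_eq_of_aeval_eq_zero hP0
    (fun i => norm (π (g i))) (fun i => u (π (g i))) (fun i => hu _) hvan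
  refine exists_ne_comparable_of_sum_mul_eq (fun i => ?_)
    (fun i => (MvPolynomial.monomial_le_degreeOf i ha).trans (P.degreeOf_le_totalDegree i))
    (fun i => (MvPolynomial.monomial_le_degreeOf i hb).trans (P.degreeOf_le_totalDegree i))
    (DFunLike.coe_injective.ne hab) hsum
  exact Nat.pos_of_ne_zero (mt norm_eq_zero.1 (hπ i))

end FreeGroup


/-- Finitely generated free groups have tame geometry at infinity (ultrafilter-free
formulation): for every `d` there is `r` such that among any `r + 1` elements of the
free group `F_d`, under every homomorphism `π : F_d → FreeGroup β` two of them have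
comparable word lengths, with a comparability constant independent of `π`. -/
theorem freeGroup_tame_geometry_at_infinity
    (β : Type*) [Finite β] [DecidableEq β] (d : ℕ) :
    ∃ r : ℕ, ∀ g : Fin (r + 1) → FreeGroup (Fin d),
      ∃ C : ℝ, 0 < C ∧ ∀ π : FreeGroup (Fin d) →* FreeGroup β,
        ∃ i j : Fin (r + 1), i ≠ j ∧
          (FreeGroup.norm (π (g i)) : ℝ) ≤ C * (FreeGroup.norm (π (g j)) : ℝ) ∧
          (FreeGroup.norm (π (g j)) : ℝ) ≤ C * (FreeGroup.norm (π (g i)) : ℝ) := by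
  refine ⟨8 * d + 1, fun g => ?_⟩
  choose C hC using fun i₀ : Fin (8 * d + 2) =>
    FreeGroup.exists_comparable_norm_of_ne_one (β := β) (by simp)
      fun i : Fin (8 * d + 1) => g (i₀.succAbove i)
  refine ⟨(∑ i, C i : ℕ) + 1, by positivity, fun π => ?_⟩
  obtain ⟨i₀, hi₀⟩ : ∃ i₀, ∀ i ≠ i₀, π (g i) = 1 → π (g i₀) = 1 := by
    by_cases h : ∃ i₀, π (g i₀) = 1
    · exact h.imp fun _ h _ _ _ => h
    · exact ⟨0, fun i _ hi => absurd ⟨i, hi⟩ h⟩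
  by_cases h : ∃ i, i ≠ i₀ ∧ π (g i) = 1
  · obtain ⟨i, hne, hi⟩ := h
    exact ⟨i, i₀, hne, by simp [hi, hi₀ i hne hi]⟩
  · push Not at h
    obtain ⟨i, j, hij, h₁, h₂⟩ := hC i₀ π fun i => h _ (Fin.succAbove_ne i₀ i)
    have hle : C i₀ ≤ ∑ i, C i + 1 :=
      (Finset.single_le_sum (fun _ _ => Nat.zero_le _) (Finset.mem_univ i₀)).trans (Nat.le_succ _)
    refine ⟨_, _, (Fin.succAbove_right_injective (p := i₀)).ne hij, ?_, ?_⟩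
    · exact_mod_cast h₁.trans (Nat.mul_le_mul_right _ hle)
    · exact_mod_cast h₂.trans (Nat.mul_le_mul_right _ hle)
end

section
/- Fix k : ℕ → ℕ. Let (N_n) be a sequence of normal subgroups of the free group F_d on d generators converging to a normal subgroup N_∞, with quotient maps q_n : F_d → Γ_n := F_d/N_n and q_∞ : F_d → Γ_∞ := F_d/N_∞, and suppose every Γ_n has k as a modulus of uniform exactness. Then the sequence converges strongly: for every finitely supported function f : F_d → ℂ, one has lim_n ‖λ_{Γ_n}((q_n)_*f)‖ = ‖λ_{Γ_∞}((q_∞)_*f)‖, where (q_n)_*f : Γ_n → ℂ is defined by ((q_n)_*f)(γ) = Σ_{w ∈ q_n⁻¹(γ)} f(w), and the norms are operator norms on ℓ²(Γ_n) and ℓ²(Γ_∞). -/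
open scoped Pointwise

noncomputable section

namespace UniformExactness

open Filter

/-- The `ℓ²`-norm of a complex-valued function, as an extended nonnegative real. -/
def l2Norm {ι : Type*} (u : ι → ℂ) : ENNReal :=
  (∑' i, ‖u i‖ₑ ^ 2) ^ (1 / 2 : ℝ)

section l2Norm

variable {ι κ : Type*}

lemma rpow_half_sq (a : ENNReal) : (a ^ (1 / 2 : ℝ)) ^ 2 = a := by
  rw [← ENNReal.rpow_natCast, ← ENNReal.rpow_mul]
  norm_num

lemma sq_rpow_half (a : ENNReal) : (a ^ 2) ^ (1 / 2 : ℝ) = a := by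
  rw [← ENNReal.rpow_natCast, ← ENNReal.rpow_mul]
  norm_num

lemma l2Norm_sq (u : ι → ℂ) : l2Norm u ^ 2 = ∑' i, ‖u i‖ₑ ^ 2 :=
  rpow_half_sq _

lemma l2Norm_le_iff {u : ι → ℂ} {c : ENNReal} :
    l2Norm u ≤ c ↔ ∑' i, ‖u i‖ₑ ^ 2 ≤ c ^ 2 := by
  rw [← l2Norm_sq]
  exact (ENNReal.pow_le_pow_left_iff two_ne_zero).symm

lemma l2Norm_eq_eLpNorm (u : ι → ℂ) :
    l2Norm u = MeasureTheory.eLpNorm u 2 (@MeasureTheory.Measure.count ι ⊤) := by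
  let _ : MeasurableSpace ι := ⊤
  rw [MeasureTheory.eLpNorm_eq_lintegral_rpow_enorm_toReal (by simp) (by simp),
    MeasureTheory.lintegral_count]
  simp [l2Norm]

lemma l2Norm_add_le (u v : ι → ℂ) : l2Norm (u + v) ≤ l2Norm u + l2Norm v := by
  let _ : MeasurableSpace ι := ⊤
  simp only [l2Norm_eq_eLpNorm]
  exact MeasureTheory.eLpNorm_add_le (measurable_from_top.aestronglyMeasurable)
    (measurable_from_top.aestronglyMeasurable) (by simp)

lemma l2Norm_zero : l2Norm (0 : ι → ℂ) = 0 := by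
  simp [l2Norm]

lemma l2Norm_sum_le {α : Type*} (s : Finset α) (u : α → ι → ℂ) :
    l2Norm (∑ a ∈ s, u a) ≤ ∑ a ∈ s, l2Norm (u a) := by
  classical
  induction s using Finset.induction_on with
  | empty => simp [l2Norm_zero]
  | insert a s ha ih =>
    rw [Finset.sum_insert ha, Finset.sum_insert ha]
    exact (l2Norm_add_le _ _).trans (by gcongr)

lemma l2Norm_comp_equiv (e : κ ≃ ι) (u : ι → ℂ) : l2Norm (fun i => u (e i)) = l2Norm u := by
  unfold l2Norm
  rw [e.tsum_eq (fun i => ‖u i‖ₑ ^ 2)]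

lemma l2Norm_coe_lp (ξ : lp (fun _ : ι => ℂ) 2) : l2Norm (ξ : ι → ℂ) = ‖ξ‖ₑ := by
  have h2 : (2 : ENNReal).toReal = 2 := by simp
  have hs : Summable fun i => ‖ξ i‖ ^ 2 := by
    simpa using (lp.memℓp ξ).summable (by simp)
  have hn : ‖ξ‖ ^ 2 = ∑' i, ‖ξ i‖ ^ 2 := by
    simpa using lp.norm_rpow_eq_tsum (by simp) ξ
  have h : ∑' i, ‖ξ i‖ₑ ^ 2 = ‖ξ‖ₑ ^ 2 := by
    rw [← ofReal_norm, ← ENNReal.ofReal_pow (norm_nonneg _), hn,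
      ENNReal.ofReal_tsum_of_nonneg (fun _ => by positivity) hs]
    refine tsum_congr fun i => ?_
    rw [← ofReal_norm, ENNReal.ofReal_pow (norm_nonneg _)]
  rw [l2Norm, h, sq_rpow_half]

end l2Norm

section Convolution

variable {Γ W : Type*} [Group Γ]

/-- Left convolution by `∑ w ∈ s, c w • δ_{g w}`. -/
def conv (s : Finset W) (c : W → ℂ) (g : W → Γ) (ξ : Γ → ℂ) (x : Γ) : ℂ :=
  ∑ w ∈ s, c w * ξ ((g w)⁻¹ * x)

/-- The norm of a convolution operator is controlled by its norm on the pieces of an almost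
invariant partition of unity. -/
lemma l2Norm_conv_le_of_partition (s : Finset W) (c : W → ℂ) (g : W → Γ) (φ : Γ → Γ → ℝ)
    (hφ : ∀ x, ∑' t, ‖φ t x‖ₑ ^ 2 = 1) (δ C : ENNReal)
    (hδ : ∀ w ∈ s, ∀ x, ∑' t, ‖φ t (g w * x) - φ t x‖ₑ ^ 2 ≤ δ ^ 2) (ξ : Γ → ℂ)
    (hC : ∀ t, l2Norm (conv s c g fun x => φ t x * ξ x) ≤ C * l2Norm fun x => φ t x * ξ x) :
    l2Norm (conv s c g ξ) ≤ (C + (∑ w ∈ s, ‖c w‖ₑ) * δ) * l2Norm ξ := by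
  have hnorm : ∀ r : ℝ, ‖(r : ℂ)‖ₑ = ‖r‖ₑ := fun r => by
    rw [← ofReal_norm, ← ofReal_norm, Complex.norm_real]
  have hpart : ∀ ζ : Γ → ℂ, ∑' t, ∑' x, ‖(φ t x : ℂ) * ζ x‖ₑ ^ 2 = ∑' x, ‖ζ x‖ₑ ^ 2 := by
    intro ζ
    rw [ENNReal.tsum_comm]
    refine tsum_congr fun x => ?_
    simp only [enorm_mul, mul_pow, hnorm]
    rw [ENNReal.tsum_mul_right, hφ, one_mul]
  set U : Γ × Γ → ℂ := fun p => φ p.1 p.2 * conv s c g ξ p.2 with hU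
  set V : Γ × Γ → ℂ := fun p => conv s c g (fun x => φ p.1 x * ξ x) p.2 with hV
  set D : W → Γ × Γ → ℂ := fun w p =>
    c w * ((φ p.1 p.2 - φ p.1 ((g w)⁻¹ * p.2) : ℝ) * ξ ((g w)⁻¹ * p.2)) with hD
  have hUVD : U = V + ∑ w ∈ s, D w := by
    ext p
    simp only [hU, hV, hD, conv, Pi.add_apply, Finset.sum_apply, Finset.mul_sum,
      ← Finset.sum_add_distrib]
    refine Finset.sum_congr rfl fun w _ => ?_
    push_cast
    ring
  have hUn : l2Norm U = l2Norm (conv s c g ξ) := by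
    unfold l2Norm
    rw [ENNReal.tsum_prod (f := fun t x => ‖(φ t x : ℂ) * conv s c g ξ x‖ₑ ^ 2), hpart]
  have hVn : l2Norm V ≤ C * l2Norm ξ := by
    rw [l2Norm_le_iff, mul_pow, l2Norm_sq, ← hpart, ← ENNReal.tsum_mul_left,
      ENNReal.tsum_prod (f := fun t x => ‖conv s c g (fun x => φ t x * ξ x) x‖ₑ ^ 2)]
    refine ENNReal.tsum_le_tsum fun t => ?_
    have := hC t
    rwa [l2Norm_le_iff, mul_pow, l2Norm_sq] at this
  have hDn : ∀ w ∈ s, l2Norm (D w) ≤ ‖c w‖ₑ * δ * l2Norm ξ := by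
    intro w hw
    rw [l2Norm_le_iff, mul_pow, mul_pow, l2Norm_sq, mul_assoc,
      ENNReal.tsum_prod (f := fun t x => ‖c w * ((φ t x - φ t ((g w)⁻¹ * x) : ℝ)
        * ξ ((g w)⁻¹ * x))‖ₑ ^ 2), ENNReal.tsum_comm,
      ← (Equiv.mulLeft (g w)).tsum_eq, ← ENNReal.tsum_mul_left, ← ENNReal.tsum_mul_left]
    refine ENNReal.tsum_le_tsum fun x => ?_
    simp only [Equiv.coe_mulLeft, inv_mul_cancel_left, enorm_mul, mul_pow, hnorm]
    rw [ENNReal.tsum_mul_left, ENNReal.tsum_mul_right]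
    gcongr
    exact hδ w hw x
  calc l2Norm (conv s c g ξ) = l2Norm (V + ∑ w ∈ s, D w) := by rw [← hUn, hUVD]
    _ ≤ l2Norm V + ∑ w ∈ s, l2Norm (D w) :=
      (l2Norm_add_le _ _).trans (by gcongr; exact l2Norm_sum_le _ _)
    _ ≤ C * l2Norm ξ + ∑ w ∈ s, ‖c w‖ₑ * δ * l2Norm ξ := by
      gcongr with w hw
      exact hDn w hw
    _ = _ := by rw [← Finset.sum_mul, ← Finset.sum_mul, add_mul]

lemma l2Norm_conv_mulRight (s : Finset W) (c : W → ℂ) (g : W → Γ) (ξ : Γ → ℂ) (t : Γ) :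
    l2Norm (conv s c g fun x => ξ (x * t)) = l2Norm (conv s c g ξ) := by
  rw [← l2Norm_comp_equiv (Equiv.mulRight t) (conv s c g ξ)]
  congr 1
  ext x
  simp [conv, mul_assoc]

end Convolution

section Pushforward

variable {G : Type*} [Group G]

/-- The convolution product on the group ring, with the left factor acting by translations. -/
def convFinsupp (f a : G →₀ ℂ) : G →₀ ℂ :=
  ∑ w ∈ f.support, f w • a.mapDomain (w * ·)

/-- The pushforward of a finitely supported function to a quotient group. -/
def push (N : Subgroup G) [N.Normal] (a : G →₀ ℂ) : G ⧸ N → ℂ :=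
  a.mapDomain (QuotientGroup.mk : G → G ⧸ N)

/-- Convolution by the pushforward of `f` to a quotient group. -/
abbrev quotConv (N : Subgroup G) [N.Normal] (f : G →₀ ℂ) : (G ⧸ N → ℂ) → G ⧸ N → ℂ :=
  conv f.support f (QuotientGroup.mk : G → G ⧸ N)

lemma quotConv_push (N : Subgroup G) [N.Normal] (f a : G →₀ ℂ) :
    quotConv N f (push N a) = push N (convFinsupp f a) := by
  ext x
  simp only [conv, push, convFinsupp, Finsupp.mapDomain_finsetSum, Finsupp.mapDomain_smul,
    Finsupp.coe_finsetSum, Finset.sum_apply, Finsupp.smul_apply, smul_eq_mul]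
  refine Finset.sum_congr rfl fun w _ => ?_
  have h : ((QuotientGroup.mk : G → G ⧸ N) ∘ fun u => w * u)
      = (fun y : G ⧸ N => (QuotientGroup.mk w : G ⧸ N) * y) ∘ QuotientGroup.mk := rfl
  rw [← Finsupp.mapDomain_comp, h, Finsupp.mapDomain_comp]
  congr 1
  have := Finsupp.mapDomain_apply (mul_right_injective (QuotientGroup.mk w : G ⧸ N))
    (a.mapDomain (QuotientGroup.mk : G → G ⧸ N)) ((QuotientGroup.mk w : G ⧸ N)⁻¹ * x)
  rw [← this, mul_inv_cancel_left]

open Classical in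
lemma support_convFinsupp_subset (f a : G →₀ ℂ) (E : Finset G) (ha : a.support ⊆ E) :
    (convFinsupp f a).support ⊆ f.support * E := by
  refine Finsupp.support_finsetSum.trans (Finset.biUnion_subset.2 fun w hw => ?_)
  refine Finsupp.support_smul.trans (Finsupp.mapDomain_support.trans ?_)
  intro x hx
  obtain ⟨u, hu, rfl⟩ := Finset.mem_image.1 hx
  exact Finset.mul_mem_mul hw (ha hu)

open Classical in
lemma push_apply (N : Subgroup G) [N.Normal] (a : G →₀ ℂ) (E : Finset G) (ha : a.support ⊆ E)
    (x : G ⧸ N) : push N a x = ∑ u ∈ E with (QuotientGroup.mk u : G ⧸ N) = x, a u := by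
  rw [push, Finsupp.mapDomain, Finsupp.sum_of_support_subset _ ha _ (by simp),
    Finsupp.finsetSum_apply, Finset.sum_filter]
  exact Finset.sum_congr rfl fun u _ => by rw [Finsupp.single_apply]

open Classical in
lemma tsum_enorm_push_sq (N : Subgroup G) [N.Normal] (a : G →₀ ℂ) (E : Finset G)
    (ha : a.support ⊆ E) :
    ∑' x, ‖push N a x‖ₑ ^ 2 = ENNReal.ofReal
      (∑ u ∈ E, starRingEnd ℂ (a u) * ∑ v ∈ E with v⁻¹ * u ∈ N, a v).re := by
  have hmk : ∀ u v : G, (QuotientGroup.mk v : G ⧸ N) = QuotientGroup.mk u ↔ v⁻¹ * u ∈ N :=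
    fun u v => QuotientGroup.eq
  set I : Finset (G ⧸ N) := E.image QuotientGroup.mk with hI
  have hzero : ∀ x ∉ I, ‖push N a x‖ₑ ^ 2 = 0 := by
    intro x hx
    rw [push_apply N a E ha, Finset.filter_false_of_mem]
    · simp
    · rintro u hu rfl
      exact hx (Finset.mem_image_of_mem _ hu)
  have hmaps : ∀ u ∈ E, (QuotientGroup.mk u : G ⧸ N) ∈ I :=
    fun u hu => Finset.mem_image_of_mem _ hu
  rw [tsum_eq_sum hzero]
  have h1 : ∀ x, ‖push N a x‖ₑ ^ 2 = ENNReal.ofReal (‖push N a x‖ ^ 2) := fun x => by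
    rw [ENNReal.ofReal_pow (norm_nonneg _), ofReal_norm]
  simp only [h1]
  rw [← ENNReal.ofReal_sum_of_nonneg (fun _ _ => by positivity)]
  congr 1
  have h2 : (∑ u ∈ E, starRingEnd ℂ (a u) * ∑ v ∈ E with v⁻¹ * u ∈ N, a v)
      = ∑ x ∈ I, ((‖push N a x‖ ^ 2 : ℝ) : ℂ) := by
    rw [← Finset.sum_fiberwise_of_maps_to hmaps]
    refine Finset.sum_congr rfl fun x _ => ?_
    have h3 : ((‖push N a x‖ ^ 2 : ℝ) : ℂ)
        = starRingEnd ℂ (push N a x) * push N a x := by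
      rw [Complex.conj_mul']
      push_cast
      rfl
    rw [h3]
    conv_rhs => rw [push_apply N a E ha]
    rw [map_sum, Finset.sum_mul]
    refine Finset.sum_congr rfl fun u hu => ?_
    obtain ⟨_, rfl⟩ := Finset.mem_filter.1 hu
    simp only [hmk]
  rw [h2, ← Complex.ofReal_sum, Complex.ofReal_re]

/-- The norm of a pushforward depends only on the coincidences among the points of a set
containing the support. -/
lemma l2Norm_push_eq (N N' : Subgroup G) [N.Normal] [N'.Normal] (a : G →₀ ℂ) (E : Finset G)
    (ha : a.support ⊆ E) (hE : ∀ u ∈ E, ∀ v ∈ E, (v⁻¹ * u ∈ N ↔ v⁻¹ * u ∈ N')) :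
    l2Norm (push N a) = l2Norm (push N' a) := by
  classical
  unfold l2Norm
  have hsum : ∑ u ∈ E, starRingEnd ℂ (a u) * ∑ v ∈ E with v⁻¹ * u ∈ N, a v
      = ∑ u ∈ E, starRingEnd ℂ (a u) * ∑ v ∈ E with v⁻¹ * u ∈ N', a v := by
    refine Finset.sum_congr rfl fun u hu => ?_
    rw [Finset.filter_congr fun v hv => hE u hu v hv]
  rw [tsum_enorm_push_sq N a E ha, tsum_enorm_push_sq N' a E ha, hsum]

lemma exists_push_eq (N : Subgroup G) [N.Normal] (E : Finset G) (ξ : G ⧸ N → ℂ)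
    (hξ : Function.support ξ ⊆ QuotientGroup.mk '' (E : Set G)) :
    ∃ a : G →₀ ℂ, a.support ⊆ E ∧ push N a = ξ := by
  classical
  have hsec : ∀ x : G ⧸ N, ∃ u : G, ξ x ≠ 0 → u ∈ E ∧ (QuotientGroup.mk u : G ⧸ N) = x := by
    intro x
    by_cases hx : ξ x = 0
    · exact ⟨1, fun h => absurd hx h⟩
    · obtain ⟨u, hu, rfl⟩ := hξ hx
      exact ⟨u, fun _ => ⟨hu, rfl⟩⟩
  choose r hr using hsec
  set b : (G ⧸ N) →₀ ℂ :=
    Finsupp.ofSupportFinite ξ ((E.finite_toSet.image _).subset hξ) with hb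
  have hbx : ∀ x, b x = ξ x := fun x => rfl
  have hbs : ∀ x ∈ b.support, ξ x ≠ 0 := fun x hx => by
    rwa [Finsupp.mem_support_iff, hbx] at hx
  refine ⟨b.mapDomain r, ?_, ?_⟩
  · intro u hu
    obtain ⟨x, hx, rfl⟩ := Finset.mem_image.1 (Finsupp.mapDomain_support hu)
    exact (hr x (hbs x hx)).1
  · ext x
    rw [push, ← Finsupp.mapDomain_comp, Finsupp.mapDomain_congr (g := id), Finsupp.mapDomain_id,
      hbx]
    exact fun x hx => (hr x (hbs x hx)).2

end Pushforward

section OperatorNorm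

variable {Γ : Type*}

lemma opNorm_le_of_finite_support {V : Type*} [SeminormedAddCommGroup V] [NormedSpace ℂ V]
    (T : lp (fun _ : Γ => ℂ) 2 →L[ℂ] V) (M : ℝ) (hM : 0 ≤ M)
    (h : ∀ ξ : lp (fun _ : Γ => ℂ) 2, (Function.support (ξ : Γ → ℂ)).Finite →
      ‖T ξ‖ ≤ M * ‖ξ‖) : ‖T‖ ≤ M := by
  classical
  refine T.opNorm_le_bound hM fun ξ => ?_
  have hclosed : IsClosed {ζ : lp (fun _ : Γ => ℂ) 2 | ‖T ζ‖ ≤ M * ‖ζ‖} :=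
    isClosed_le (by fun_prop) (by fun_prop)
  refine hclosed.mem_of_tendsto (lp.hasSum_single (by simp) ξ) (Eventually.of_forall fun s => ?_)
  refine h _ (s.finite_toSet.subset fun x hx => ?_)
  by_contra hxs
  refine hx ?_
  rw [lp.coeFn_sum, Finset.sum_apply]
  refine Finset.sum_eq_zero fun i hi => ?_
  rw [lp.single_apply, Pi.single_eq_of_ne]
  rintro rfl
  exact hxs hi

end OperatorNorm

section UniformExactness

variable {Γ W : Type*} [Group Γ]

lemma sq_sqrt_sub_sqrt_le {a b : ℝ} (ha : 0 ≤ a) (hb : 0 ≤ b) :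
    (√a - √b) ^ 2 ≤ |a - b| := by
  have ha' := Real.sq_sqrt ha
  have hb' := Real.sq_sqrt hb
  have hpa := Real.sqrt_nonneg a
  have hpb := Real.sqrt_nonneg b
  rcases le_total (√a) (√b) with h | h
  · refine le_trans ?_ (neg_le_abs _)
    nlinarith
  · refine le_trans ?_ (le_abs_self _)
    nlinarith

lemma tsum_ofReal_eq_ofReal_finsum {ι : Type*} {u : ι → ℝ} (hu : ∀ i, 0 ≤ u i)
    (hfin : (Function.support u).Finite) :
    ∑' i, ENNReal.ofReal (u i) = ENNReal.ofReal (∑ᶠ i, u i) := by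
  rw [← tsum_eq_finsum (L := .unconditional ι) hfin, ENNReal.ofReal_tsum_of_nonneg hu (summable_of_hasFiniteSupport hfin)]

/-- Operator norm localization: in a group with modulus of uniform exactness `k`, the norm of a
convolution operator supported in `F` is nearly attained on right translates of
`F ^ k F.card`. -/
lemma l2Norm_conv_le_of_isUEModulus {k : ℕ → ℕ} (h : IsUEModulus k Γ) (F : Finset Γ)
    (hone : 1 ∈ F) (hinv : ∀ t ∈ F, t⁻¹ ∈ F) (s : Finset W) (c : W → ℂ) (g : W → Γ)
    (hg : ∀ w ∈ s, g w ∈ F) (δ : ℝ) (hδ : 0 ≤ δ) (hδF : 1 / (F.card : ℝ) ≤ δ ^ 2) (C : ENNReal)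
    (hC : ∀ (ζ : Γ → ℂ) (t : Γ), (∀ x, ζ x ≠ 0 → x * t ∈ (F : Set Γ) ^ k F.card) →
      l2Norm (conv s c g ζ) ≤ C * l2Norm ζ) (ξ : Γ → ℂ) :
    l2Norm (conv s c g ξ) ≤ (C + (∑ w ∈ s, ‖c w‖ₑ) * ENNReal.ofReal δ) * l2Norm ξ := by
  classical
  obtain ⟨η, hpos, hsupp, hsum, hinvar⟩ := h F hone hinv
  have hfin : ∀ x, (Function.support (η x)).Finite := fun x =>
    (Finset.coe_pow F (k F.card) ▸ (F ^ k F.card).finite_toSet).subset (hsupp x)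
  have hfin' : ∀ a x, (Function.support fun t => η x (a⁻¹ * t)).Finite := fun a x =>
    (hfin x).preimage (f := fun t => a⁻¹ * t) (mul_right_injective _).injOn
  have hfind : ∀ a x, (Function.support fun t => |η (a * x) t - η x (a⁻¹ * t)|).Finite := by
    intro a x
    refine ((hfin (a * x)).union (hfin' a x)).subset fun t ht => ?_
    by_contra hcon
    simp only [Set.mem_union, Function.mem_support, not_or, not_not] at hcon
    simp [hcon.1, hcon.2] at ht
  have hle2 : ∀ a x, ∑ᶠ t, |η (a * x) t - η x (a⁻¹ * t)| ≤ 2 := by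
    intro a x
    have hx : ∑ᶠ t, η x (a⁻¹ * t) = 1 := by
      rw [← hsum x]
      exact finsum_comp_equiv (Equiv.mulLeft a⁻¹)
    calc ∑ᶠ t, |η (a * x) t - η x (a⁻¹ * t)|
        ≤ ∑ᶠ t, (η (a * x) t + η x (a⁻¹ * t)) := by
          have hfina := ((hfin (a * x)).union (hfin' a x)).subset (Function.support_add _ _)
          rw [← tsum_eq_finsum (L := .unconditional Γ) (hfind a x),
            ← tsum_eq_finsum (L := .unconditional Γ) hfina]
          refine Summable.tsum_le_tsum (fun t => ?_) (summable_of_hasFiniteSupport (hfind a x))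
            (summable_of_hasFiniteSupport hfina)
          have h1 := hpos (a * x) t
          have h2 := hpos x (a⁻¹ * t)
          rw [abs_le]
          constructor <;> linarith
      _ = 2 := by
          rw [finsum_add_distrib (hfin _) (hfin' a x), hsum, hx]
          norm_num
  have hbound : ∀ a ∈ F, ∀ x, ∑ᶠ t, |η (a * x) t - η x (a⁻¹ * t)| ≤ δ ^ 2 := by
    intro a ha x
    refine le_trans ?_ hδF
    refine le_trans ?_ hinvar
    refine le_trans ?_ (Finset.single_le_sum (f := fun b => ⨆ x : Γ,
      ∑ᶠ t, |η (b * x) t - η x (b⁻¹ * t)|)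
      (fun b _ => Real.iSup_nonneg fun x => finsum_nonneg fun t => abs_nonneg _) ha)
    exact le_ciSup (f := fun x => ∑ᶠ t, |η (a * x) t - η x (a⁻¹ * t)|)
      ⟨2, by rintro _ ⟨y, rfl⟩; exact hle2 a y⟩ x
  have hsq : ∀ r : ℝ, ‖r‖ₑ ^ 2 = ENNReal.ofReal (r ^ 2) := fun r => by
    rw [← ofReal_norm, ← ENNReal.ofReal_pow (norm_nonneg _), Real.norm_eq_abs, sq_abs]
  refine l2Norm_conv_le_of_partition s c g (fun t x => √(η x (x * t))) (fun x => ?_) _ C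
    (fun w hw x => ?_) ξ (fun t => hC _ t fun x hx => ?_)
  · simp only [hsq, Real.sq_sqrt (hpos _ _)]
    refine ((Equiv.mulLeft x).tsum_eq (fun t => ENNReal.ofReal (η x t))).trans ?_
    rw [tsum_ofReal_eq_ofReal_finsum (hpos x) (hfin x), hsum, ENNReal.ofReal_one]
  · rw [← ENNReal.ofReal_pow hδ]
    calc ∑' t, ‖√(η (g w * x) (g w * x * t)) - √(η x (x * t))‖ₑ ^ 2
        ≤ ∑' t, ENNReal.ofReal |η (g w * x) (g w * x * t) - η x ((g w)⁻¹ * (g w * x * t))| := by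
          refine ENNReal.tsum_le_tsum fun t => ?_
          rw [hsq, mul_assoc, inv_mul_cancel_left]
          exact ENNReal.ofReal_le_ofReal (sq_sqrt_sub_sqrt_le (hpos _ _) (hpos _ _))
      _ = ∑' t, ENNReal.ofReal |η (g w * x) t - η x ((g w)⁻¹ * t)| :=
          (Equiv.mulLeft (g w * x)).tsum_eq
            (fun t => ENNReal.ofReal |η (g w * x) t - η x ((g w)⁻¹ * t)|)
      _ = ENNReal.ofReal (∑ᶠ t, |η (g w * x) t - η x ((g w)⁻¹ * t)|) :=
          tsum_ofReal_eq_ofReal_finsum (fun _ => abs_nonneg _) (hfind _ _)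
      _ ≤ ENNReal.ofReal (δ ^ 2) := ENNReal.ofReal_le_ofReal (hbound _ (hg w hw) x)
  · refine hsupp x fun h0 => hx ?_
    simp [h0]

end UniformExactness

section Convergence

variable {G : Type*} [Group G] {N : ℕ → Subgroup G} {Ninf : Subgroup G}

lemma eventually_mem_iff
    (hconv : ∀ w : G, (∀ᶠ n in atTop, w ∈ N n) ∨ (∀ᶠ n in atTop, w ∉ N n))
    (hlim : ∀ w : G, w ∈ Ninf ↔ ∀ᶠ n in atTop, w ∈ N n) (P : Finset G) :
    ∀ᶠ n in atTop, ∀ w ∈ P, (w ∈ N n ↔ w ∈ Ninf) := by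
  rw [eventually_all_finset]
  intro w _
  by_cases hw : w ∈ Ninf
  · filter_upwards [(hlim w).1 hw] with n hn
    simp [hn, hw]
  · filter_upwards [(hconv w).resolve_left fun h => hw ((hlim w).2 h)] with n hn
    simp [hn, hw]

/-- If the limit group is finite, some finite set surjects onto all but finitely many of the
approximating groups. -/
lemma exists_finset_eventually_surjOn [Group.FG G] [Finite (G ⧸ Ninf)]
    (hN : ∀ P : Finset G, ∀ᶠ n in atTop, ∀ w ∈ P, (w ∈ N n ↔ w ∈ Ninf)) :
    ∃ E : Finset G, ∀ᶠ n in atTop,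
      ∀ x : G ⧸ N n, x ∈ (QuotientGroup.mk : G → G ⧸ N n) '' (E : Set G) := by
  classical
  have := Fintype.ofFinite (G ⧸ Ninf)
  have : Ninf.FiniteIndex := Subgroup.finiteIndex_of_finite_quotient
  obtain ⟨S, hS⟩ := (Group.fg_iff_subgroup_fg Ninf).1 (Subgroup.fg_of_index_ne_zero Ninf)
  refine ⟨Finset.univ.image (Quotient.out : G ⧸ Ninf → G), ?_⟩
  filter_upwards [hN S] with n hn x
  have hle : Ninf ≤ N n := by
    rw [← hS, Subgroup.closure_le]
    exact fun w hw => (hn w hw).2 (hS ▸ Subgroup.subset_closure hw)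
  obtain ⟨u, rfl⟩ := QuotientGroup.mk_surjective x
  refine ⟨(QuotientGroup.mk u : G ⧸ Ninf).out, by simp, ?_⟩
  rw [QuotientGroup.eq]
  apply hle
  rw [← QuotientGroup.eq]
  exact Quotient.out_eq _

variable [∀ n, (N n).Normal] [Ninf.Normal]

lemma eventually_l2Norm_push_eq
    (hN : ∀ P : Finset G, ∀ᶠ n in atTop, ∀ w ∈ P, (w ∈ N n ↔ w ∈ Ninf)) (E : Finset G) :
    ∀ᶠ n in atTop, ∀ a : G →₀ ℂ, a.support ⊆ E →
      l2Norm (push (N n) a) = l2Norm (push Ninf a) := by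
  classical
  filter_upwards [hN (E⁻¹ * E)] with n hn a ha
  exact l2Norm_push_eq _ _ a E ha fun u hu v hv =>
    hn _ (Finset.mul_mem_mul (Finset.inv_mem_inv hv) hu)

/-- A norm bound for convolution on the limit group holds, far along the sequence, for functions
supported in a right translate of the image of a fixed finite set. -/
lemma eventually_l2Norm_quotConv_le_of_support
    (hN : ∀ P : Finset G, ∀ᶠ n in atTop, ∀ w ∈ P, (w ∈ N n ↔ w ∈ Ninf)) (f : G →₀ ℂ)
    (C : ENNReal) (hC : ∀ a, l2Norm (quotConv Ninf f (push Ninf a)) ≤ C * l2Norm (push Ninf a))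
    (E : Finset G) :
    ∀ᶠ n in atTop, ∀ (ζ : G ⧸ N n → ℂ) (t : G ⧸ N n),
      (∀ x, ζ x ≠ 0 → x * t ∈ (QuotientGroup.mk : G → G ⧸ N n) '' (E : Set G)) →
      l2Norm (quotConv (N n) f ζ) ≤ C * l2Norm ζ := by
  classical
  filter_upwards [eventually_l2Norm_push_eq hN E, eventually_l2Norm_push_eq hN (f.support * E)]
    with n hE hfE ζ t hζ
  obtain ⟨a, ha, hpush⟩ := exists_push_eq (N n) E (fun x => ζ (x * t⁻¹)) fun x hx => by
    simpa using hζ _ hx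
  have h1 : l2Norm (quotConv (N n) f ζ) = l2Norm (push (N n) (convFinsupp f a)) := by
    rw [← quotConv_push, hpush, quotConv, l2Norm_conv_mulRight]
  have h2 : l2Norm ζ = l2Norm (push (N n) a) := by
    rw [hpush]
    exact (l2Norm_comp_equiv (Equiv.mulRight t⁻¹) ζ).symm
  rw [h1, h2, hE a ha, hfE _ (support_convFinsupp_subset f a E ha), ← quotConv_push]
  exact hC a

/-- Asymptotic upper bound for the norms of convolution operators. -/
lemma eventually_l2Norm_quotConv_le [Group.FG G] {k : ℕ → ℕ}
    (hN : ∀ P : Finset G, ∀ᶠ n in atTop, ∀ w ∈ P, (w ∈ N n ↔ w ∈ Ninf))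
    (hUE : ∀ n, IsUEModulus k (G ⧸ N n)) (f : G →₀ ℂ)
    (C : ENNReal) (hC : ∀ a, l2Norm (quotConv Ninf f (push Ninf a)) ≤ C * l2Norm (push Ninf a))
    (ε : ℝ) (hε : 0 < ε) :
    ∀ᶠ n in atTop, ∀ ξ : G ⧸ N n → ℂ,
      l2Norm (quotConv (N n) f ξ) ≤ (C + ENNReal.ofReal ε) * l2Norm ξ := by
  classical
  rcases finite_or_infinite (G ⧸ Ninf) with hfinite | hinfinite
  · obtain ⟨E, hE⟩ := exists_finset_eventually_surjOn hN
    filter_upwards [hE, eventually_l2Norm_quotConv_le_of_support hN f C hC E] with n hsurj hn ξ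
    refine (hn ξ 1 fun x _ => hsurj _).trans ?_
    gcongr
    exact le_self_add
  set B : ℝ := ∑ w ∈ f.support, ‖f w‖ with hB
  have hB0 : 0 ≤ B := Finset.sum_nonneg fun _ _ => norm_nonneg _
  set δ : ℝ := ε / (B + 1) with hδ
  have hδ0 : 0 < δ := by positivity
  have hBδ : B * δ ≤ ε := by
    rw [hδ, mul_div_assoc', div_le_iff₀ (by positivity)]
    nlinarith
  obtain ⟨M, hM⟩ := exists_nat_gt (1 / δ ^ 2)
  obtain ⟨A, hA⟩ := Infinite.exists_subset_card_eq (G ⧸ Ninf) M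
  set S₀ : Finset G := A.image Quotient.out with hS₀
  have hS₀card : S₀.card = M := by
    rw [hS₀, Finset.card_image_of_injective _ Quotient.out_injective, hA]
  have hS₀inj : ∀ u ∈ S₀, ∀ v ∈ S₀, u⁻¹ * v ∈ Ninf → u = v := by
    intro u hu v hv huv
    obtain ⟨x, _, rfl⟩ := Finset.mem_image.1 hu
    obtain ⟨y, _, rfl⟩ := Finset.mem_image.1 hv
    rw [← QuotientGroup.eq] at huv
    have hx : (QuotientGroup.mk x.out : G ⧸ Ninf) = x := Quotient.out_eq _
    have hy : (QuotientGroup.mk y.out : G ⧸ Ninf) = y := Quotient.out_eq _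
    rw [hx, hy] at huv
    rw [huv]
  set S₁ : Finset G := insert 1 (S₀ ∪ f.support) with hS₁
  set S : Finset G := S₁ ∪ S₁⁻¹ with hS
  have hS1 : 1 ∈ S := by simp [hS, hS₁]
  set K : ℕ := (Finset.range (S.card + 1)).sup k with hK
  filter_upwards [hN (S₀⁻¹ * S₀), eventually_l2Norm_quotConv_le_of_support hN f C hC (S ^ K)]
    with n hn hloc ξ
  set F : Finset (G ⧸ N n) := S.image QuotientGroup.mk with hF
  have hFcard : F.card ≤ S.card := Finset.card_image_le
  have hMF : M ≤ F.card := by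
    rw [← hS₀card, ← Finset.card_image_of_injOn (s := S₀) (f := (QuotientGroup.mk : G → G ⧸ N n))]
    · refine Finset.card_le_card (Finset.image_subset_image ?_)
      intro u hu
      simp [hS, hS₁, hu]
    · intro u hu v hv huv
      refine hS₀inj u hu v hv ?_
      rw [← hn _ (Finset.mul_mem_mul (Finset.inv_mem_inv hu) hv), ← QuotientGroup.eq]
      exact huv
  have hδF : 1 / (F.card : ℝ) ≤ δ ^ 2 := by
    have hMF' : (M : ℝ) ≤ F.card := by exact_mod_cast hMF
    rw [one_div_le (lt_of_lt_of_le (lt_trans (by positivity) hM) hMF') (by positivity)]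
    exact hM.le.trans hMF'
  have hpow : (F : Set (G ⧸ N n)) ^ k F.card ⊆
      (QuotientGroup.mk : G → G ⧸ N n) '' ((S ^ K : Finset G) : Set G) := by
    have himage : (QuotientGroup.mk : G → G ⧸ N n) '' ((S ^ K : Finset G) : Set G)
        = (F : Set (G ⧸ N n)) ^ K := by
      rw [Finset.coe_pow, hF, Finset.coe_image]
      exact Set.image_pow (QuotientGroup.mk' (N n)) _ _
    rw [himage]
    refine Set.pow_subset_pow_right ?_ ?_
    · exact Finset.mem_coe.2 (Finset.mem_image.2 ⟨1, hS1, rfl⟩)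
    · exact Finset.le_sup (f := k) (Finset.mem_range.2 (by omega))
  have hkey := l2Norm_conv_le_of_isUEModulus (hUE n) F (Finset.mem_image.2 ⟨1, hS1, rfl⟩)
    (fun t ht => by
      obtain ⟨u, hu, rfl⟩ := Finset.mem_image.1 ht
      refine Finset.mem_image.2 ⟨u⁻¹, ?_, rfl⟩
      simp only [hS, Finset.mem_union, Finset.mem_inv', inv_inv] at hu ⊢
      exact hu.symm)
    f.support f (QuotientGroup.mk : G → G ⧸ N n)
    (fun w hw => Finset.mem_image_of_mem _ (by
      rw [hS, hS₁]
      exact Finset.mem_union_left _ (Finset.mem_insert_of_mem (Finset.mem_union_right _ hw))))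
    δ hδ0.le hδF C (fun ζ t hζ => hloc ζ t fun x hx => hpow (hζ x hx)) ξ
  refine hkey.trans ?_
  gcongr
  have hBe : ∑ w ∈ f.support, ‖f w‖ₑ = ENNReal.ofReal B := by
    rw [hB, ENNReal.ofReal_sum_of_nonneg fun _ _ => norm_nonneg _]
    simp only [ofReal_norm]
  rw [hBe, ← ENNReal.ofReal_mul hB0]
  exact ENNReal.ofReal_le_ofReal hBδ

end Convergence

section Operator

variable {G : Type*} [Group G]

/-- The pushforward of a finitely supported function, as a vector of `ℓ²`. -/
lemma exists_lp_coe_eq_push (N : Subgroup G) [N.Normal] (a : G →₀ ℂ) :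
    ∃ ξ : lp (fun _ : G ⧸ N => ℂ) 2, (ξ : G ⧸ N → ℂ) = push N a := by
  refine ⟨⟨push N a, memℓp_gen (summable_of_hasFiniteSupport ?_)⟩, rfl⟩
  refine (Finsupp.hasFiniteSupport (a.mapDomain (QuotientGroup.mk : G → G ⧸ N))).subset ?_
  intro x hx h0
  refine hx ?_
  have h0' : push N a x = 0 := h0
  simp [h0']

variable {N : Subgroup G} [N.Normal] {f : G →₀ ℂ}
  {T : lp (fun _ : G ⧸ N => ℂ) 2 →L[ℂ] lp (fun _ : G ⧸ N => ℂ) 2}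

lemma l2Norm_quotConv_coe (hT : ∀ ξ, (T ξ : G ⧸ N → ℂ) = quotConv N f ξ)
    (ξ : lp (fun _ : G ⧸ N => ℂ) 2) : l2Norm (quotConv N f ξ) = ‖T ξ‖ₑ := by
  rw [← hT, l2Norm_coe_lp]

lemma l2Norm_quotConv_push_le (hT : ∀ ξ, (T ξ : G ⧸ N → ℂ) = quotConv N f ξ) (a : G →₀ ℂ) :
    l2Norm (quotConv N f (push N a)) ≤ ENNReal.ofReal ‖T‖ * l2Norm (push N a) := by
  obtain ⟨ξ, hξ⟩ := exists_lp_coe_eq_push N a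
  rw [← hξ, l2Norm_quotConv_coe hT, l2Norm_coe_lp, ← ofReal_norm, ← ofReal_norm,
    ← ENNReal.ofReal_mul (norm_nonneg _)]
  exact ENNReal.ofReal_le_ofReal (T.le_opNorm ξ)

lemma opNorm_le_of_l2Norm_quotConv_le (hT : ∀ ξ, (T ξ : G ⧸ N → ℂ) = quotConv N f ξ) (M : ℝ)
    (hM : 0 ≤ M) (h : ∀ ξ, l2Norm (quotConv N f ξ) ≤ ENNReal.ofReal M * l2Norm ξ) : ‖T‖ ≤ M := by
  refine T.opNorm_le_bound hM fun ξ => ?_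
  have hξ := h ξ
  rwa [l2Norm_quotConv_coe hT, l2Norm_coe_lp, ← ofReal_norm, ← ofReal_norm,
    ← ENNReal.ofReal_mul hM, ENNReal.ofReal_le_ofReal_iff (by positivity)] at hξ

lemma opNorm_le_of_l2Norm_push_le (hT : ∀ ξ, (T ξ : G ⧸ N → ℂ) = quotConv N f ξ) (M : ℝ)
    (hM : 0 ≤ M)
    (h : ∀ a, l2Norm (push N (convFinsupp f a)) ≤ ENNReal.ofReal M * l2Norm (push N a)) :
    ‖T‖ ≤ M := by
  classical
  refine opNorm_le_of_finite_support T M hM fun ξ hfin => ?_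
  obtain ⟨a, -, ha⟩ := exists_push_eq N (hfin.toFinset.image Quotient.out) ξ fun x hx =>
    ⟨x.out, Finset.mem_image_of_mem _ (hfin.mem_toFinset.2 hx), Quotient.out_eq _⟩
  have hξ := h a
  rwa [← quotConv_push, ha, l2Norm_quotConv_coe hT, l2Norm_coe_lp, ← ofReal_norm, ← ofReal_norm,
    ← ENNReal.ofReal_mul hM, ENNReal.ofReal_le_ofReal_iff (by positivity)] at hξ

end Operator

end UniformExactness

/-- Strong convergence for convergent sequences of marked groups in `UE(k)`:
if normal subgroups `N n ⊴ F_d` converge to `N∞` and every quotient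
`Γ_n = F_d ⧸ N n` has `k` as a modulus of uniform exactness, then for every finitely
supported `f : F_d → ℂ`, the operator norms of `λ_{Γ_n}((q_n)_* f)` on `ℓ²(Γ_n)`
converge to the operator norm of `λ_{Γ_∞}((q_∞)_* f)` on `ℓ²(Γ_∞)`.  The operators
`T n = λ_{Γ_n}((q_n)_* f)` and `Tinf = λ_{Γ_∞}((q_∞)_* f)` are characterized
pointwise via `(λ(q_* f) ξ)(x) = ∑_w f(w) ξ(q(w)⁻¹ x)`. -/
theorem strong_convergence_of_isUEModulus
    (k : ℕ → ℕ) (d : ℕ)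
    (N : ℕ → Subgroup (FreeGroup (Fin d))) [∀ n, (N n).Normal]
    (Ninf : Subgroup (FreeGroup (Fin d))) [Ninf.Normal]
    (hconv : ∀ w : FreeGroup (Fin d),
      (∀ᶠ n in Filter.atTop, w ∈ N n) ∨ (∀ᶠ n in Filter.atTop, w ∉ N n))
    (hlim : ∀ w : FreeGroup (Fin d), w ∈ Ninf ↔ ∀ᶠ n in Filter.atTop, w ∈ N n)
    (hUE : ∀ n, IsUEModulus k (FreeGroup (Fin d) ⧸ N n))
    (f : FreeGroup (Fin d) →₀ ℂ)
    (T : ∀ n : ℕ, lp (fun _ : FreeGroup (Fin d) ⧸ N n => ℂ) 2 →L[ℂ]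
      lp (fun _ : FreeGroup (Fin d) ⧸ N n => ℂ) 2)
    (hT : ∀ (n : ℕ) (ξ : lp (fun _ : FreeGroup (Fin d) ⧸ N n => ℂ) 2)
        (x : FreeGroup (Fin d) ⧸ N n),
      T n ξ x = ∑ w ∈ f.support,
        f w * ξ ((QuotientGroup.mk w : FreeGroup (Fin d) ⧸ N n)⁻¹ * x))
    (Tinf : lp (fun _ : FreeGroup (Fin d) ⧸ Ninf => ℂ) 2 →L[ℂ]
      lp (fun _ : FreeGroup (Fin d) ⧸ Ninf => ℂ) 2)
    (hTinf : ∀ (ξ : lp (fun _ : FreeGroup (Fin d) ⧸ Ninf => ℂ) 2)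
        (x : FreeGroup (Fin d) ⧸ Ninf),
      Tinf ξ x = ∑ w ∈ f.support,
        f w * ξ ((QuotientGroup.mk w : FreeGroup (Fin d) ⧸ Ninf)⁻¹ * x)) :
    Filter.Tendsto (fun n => ‖T n‖) Filter.atTop (nhds ‖Tinf‖) := by
  have hN := UniformExactness.eventually_mem_iff hconv hlim
  have hT' : ∀ n ξ, (T n ξ : FreeGroup (Fin d) ⧸ N n → ℂ)
      = UniformExactness.quotConv (N n) f ξ := fun n ξ => funext (hT n ξ)
  have hTinf' : ∀ ξ, (Tinf ξ : FreeGroup (Fin d) ⧸ Ninf → ℂ)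
      = UniformExactness.quotConv Ninf f ξ := fun ξ => funext (hTinf ξ)
  refine tendsto_order.2 ⟨fun b hb => ?_, fun b hb => ?_⟩
  · rcases lt_or_ge b 0 with hb0 | hb0
    · exact Filter.Eventually.of_forall fun n => hb0.trans_le (norm_nonneg _)
    obtain ⟨a, ha⟩ : ∃ a, ENNReal.ofReal b * UniformExactness.l2Norm (UniformExactness.push Ninf a)
        < UniformExactness.l2Norm
          (UniformExactness.push Ninf (UniformExactness.convFinsupp f a)) := by
      by_contra! hcon
      exact hb.not_ge (UniformExactness.opNorm_le_of_l2Norm_push_le hTinf' b hb0 hcon)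
    filter_upwards [UniformExactness.eventually_l2Norm_push_eq hN a.support,
      UniformExactness.eventually_l2Norm_push_eq hN (UniformExactness.convFinsupp f a).support]
      with n h1 h2
    by_contra! hcon
    refine ha.not_ge ?_
    rw [← h1 a subset_rfl, ← h2 _ subset_rfl, ← UniformExactness.quotConv_push]
    refine (UniformExactness.l2Norm_quotConv_push_le (hT' n) a).trans ?_
    gcongr
  · set ε : ℝ := (b - ‖Tinf‖) / 2 with hε
    have hε0 : 0 < ε := by rw [hε]; linarith
    filter_upwards [UniformExactness.eventually_l2Norm_quotConv_le hN hUE f _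
      (UniformExactness.l2Norm_quotConv_push_le hTinf') ε hε0] with n hn
    have hle : ‖T n‖ ≤ ‖Tinf‖ + ε := by
      refine UniformExactness.opNorm_le_of_l2Norm_quotConv_le (hT' n) _ (by positivity) ?_
      rwa [ENNReal.ofReal_add (norm_nonneg _) hε0.le]
    rw [hε] at hle
    linarith

end
end
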